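/- Let n ≥ 2 and 0 < μ < n. Suppose u ∈ Cⁿ(ℝⁿ) satisfies condition (B) and the integral equation (IE). Then there exists a vector b̄ ∈ ℝⁿ such that λ_{b̄} > 0. -/

import Mathlib

open MeasureTheory Real Filter Metric

noncomputable section

/-- The nonlocal term `v(x) = ∫ e^{((2n-μ)/2) u(y)} / |x-y|^μ dy`. -/
noncomputable def V (n : ℕ) (μ : ℝ) (u : EuclideanSpace ℝ (Fin n) → ℝ)
    (x : EuclideanSpace ℝ (Fin n)) : ℝ :=
  ∫ y : EuclideanSpace ℝ (Fin n),
    Real.exp ((2 * n - μ) / 2 * u y) / ‖x - y‖ ^ μ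

/-- `βₙ = 2^{n-1} Γ(n/2+1) Γ(n/2) ωₙ` with `ωₙ` the volume of the unit ball in `ℝⁿ`. -/
noncomputable def betaN (n : ℕ) : ℝ :=
  2 ^ (n - 1) * Real.Gamma ((n : ℝ) / 2 + 1) * Real.Gamma ((n : ℝ) / 2) *
    (volume (Metric.ball (0 : EuclideanSpace ℝ (Fin n)) 1)).toReal

/-- Condition (B): finite weighted volume and finite total curvature. -/
def CondB (n : ℕ) (μ : ℝ) (u : EuclideanSpace ℝ (Fin n) → ℝ) : Prop :=
  Integrable (fun y : EuclideanSpace ℝ (Fin n) => Real.exp ((2 * n - μ) / 2 * u y)) ∧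
  Integrable (fun p : EuclideanSpace ℝ (Fin n) × EuclideanSpace ℝ (Fin n) =>
    Real.exp ((2 * n - μ) / 2 * u p.1) * Real.exp ((2 * n - μ) / 2 * u p.2) / ‖p.1 - p.2‖ ^ μ)

/-- The integral equation (IE). -/
def IE (n : ℕ) (μ : ℝ) (u : EuclideanSpace ℝ (Fin n) → ℝ) : Prop :=
  ∃ C : ℝ, ∀ x : EuclideanSpace ℝ (Fin n), u x = (1 / betaN n) *
    (∫ y, Real.log ((‖y‖ + 1) / ‖x - y‖) * (V n μ u y * Real.exp ((2 * n - μ) / 2 * u y))) + C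

/-- `α = (1/βₙ) ∫ v(y) e^{((2n-μ)/2) u(y)} dy`. -/
noncomputable def alphaC (n : ℕ) (μ : ℝ) (u : EuclideanSpace ℝ (Fin n) → ℝ) : ℝ :=
  (1 / betaN n) * ∫ y, V n μ u y * Real.exp ((2 * n - μ) / 2 * u y)

/-- `w_{λ,b}(x) = u(b + x/|x|²) − 2 ln|x| − u(b + x/λ²) + 2 ln λ`. -/
noncomputable def wMS (n : ℕ) (u : EuclideanSpace ℝ (Fin n) → ℝ)
    (b : EuclideanSpace ℝ (Fin n)) (l : ℝ) (x : EuclideanSpace ℝ (Fin n)) : ℝ :=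
  u (b + (‖x‖ ^ 2)⁻¹ • x) - 2 * Real.log ‖x‖ - u (b + (l ^ 2)⁻¹ • x) + 2 * Real.log l

/-- `z_{λ,b}(x) = |x|^{−μ} v(b + x/|x|²) − λ^{−μ} v(b + x/λ²)`. -/
noncomputable def zMS (n : ℕ) (μ : ℝ) (u : EuclideanSpace ℝ (Fin n) → ℝ)
    (b : EuclideanSpace ℝ (Fin n)) (l : ℝ) (x : EuclideanSpace ℝ (Fin n)) : ℝ :=
  ‖x‖ ^ (-μ) * V n μ u (b + (‖x‖ ^ 2)⁻¹ • x) - l ^ (-μ) * V n μ u (b + (l ^ 2)⁻¹ • x)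

/-- The critical moving-spheres radius `λ_b`. -/
noncomputable def lambdaB (n : ℕ) (μ : ℝ) (u : EuclideanSpace ℝ (Fin n) → ℝ)
    (b : EuclideanSpace ℝ (Fin n)) : ℝ :=
  sInf {l : ℝ | 0 < l ∧ ∀ ρ : ℝ, l ≤ ρ → ∀ x : EuclideanSpace ℝ (Fin n),
    0 < ‖x‖ → ‖x‖ < ρ → 0 ≤ wMS n u b ρ x ∧ 0 ≤ zMS n μ u b ρ x}

/-- The kernel `‖z‖⁻ˢ` is integrable on bounded balls when `s < n`. -/
lemma integrableOn_ball_norm_rpow_inv {n : ℕ} (hn : 1 ≤ n) {s r : ℝ} (hs : s < n) :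
    IntegrableOn (fun z : EuclideanSpace ℝ (Fin n) => (‖z‖ ^ s)⁻¹) (ball 0 r) := by
  have : Nonempty (Fin n) := ⟨⟨0, hn⟩⟩
  rw [integrableOn_fun_norm_addHaar volume (f := fun t : ℝ => (t ^ s)⁻¹)]
  have h : IntegrableOn (fun y : ℝ => y ^ ((n : ℝ) - 1 - s)) (Set.Ioo 0 r) := by
    rcases le_or_gt r 0 with hr | hr
    · simp [Set.Ioo_eq_empty_of_le hr]
    · have := (intervalIntegral.intervalIntegrable_rpow' (a := 0) (b := r)
        (r := (n : ℝ) - 1 - s) (by linarith)).1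
      exact this.mono_set Set.Ioo_subset_Ioc_self
  refine h.congr_fun (fun y hy => ?_) measurableSet_Ioo
  simp only [finrank_euclideanSpace_fin, smul_eq_mul]
  rw [Real.rpow_sub hy.1, ← Real.rpow_natCast, Nat.cast_sub hn]
  simp [div_eq_mul_inv]

/-- Riesz potentials of integrable, locally bounded functions are finite and locally bounded. -/
lemma exists_riesz_bound {n : ℕ} (hn : 1 ≤ n) {s : ℝ} (hs0 : 0 ≤ s) (hs : s < n)
    {g : EuclideanSpace ℝ (Fin n) → ℝ} (hg0 : ∀ x, 0 ≤ g x) (hg : Integrable g)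
    (hgb : ∀ r : ℝ, ∃ B, ∀ x, ‖x‖ ≤ r → g x ≤ B) (r : ℝ) :
    ∃ C, ∀ x, ‖x‖ ≤ r → Integrable (fun y => g y / ‖x - y‖ ^ s) ∧
      ∫ y, g y / ‖x - y‖ ^ s ≤ C := by
  obtain ⟨B, hB⟩ := hgb (r + 1)
  set K : EuclideanSpace ℝ (Fin n) → ℝ :=
    (ball 0 1).indicator (fun z => (‖z‖ ^ s)⁻¹) with hK
  have hKi : Integrable K :=
    (integrable_indicator_iff measurableSet_ball).2 (integrableOn_ball_norm_rpow_inv hn hs)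
  refine ⟨(∫ y, g y) + max B 0 * ∫ z, K z, fun x hx => ?_⟩
  have hdom : Integrable (fun y => g y + max B 0 * K (x - y)) :=
    hg.add ((hKi.comp_sub_left x).const_mul _)
  have hle : ∀ y, g y / ‖x - y‖ ^ s ≤ g y + max B 0 * K (x - y) := by
    intro y
    by_cases hxy : ‖x - y‖ < 1
    · have hmem : x - y ∈ ball (0 : EuclideanSpace ℝ (Fin n)) 1 := by simpa using hxy
      have hy : ‖y‖ ≤ r + 1 := by
        have := norm_sub_norm_le y x
        rw [norm_sub_rev] at this
        linarith
      rw [hK, Set.indicator_of_mem hmem, div_eq_mul_inv]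
      have : g y * (‖x - y‖ ^ s)⁻¹ ≤ max B 0 * (‖x - y‖ ^ s)⁻¹ := by
        gcongr
        exact (hB y hy).trans (le_max_left _ _)
      linarith [hg0 y]
    · have hmem : x - y ∉ ball (0 : EuclideanSpace ℝ (Fin n)) 1 := by simpa using hxy
      rw [hK, Set.indicator_of_notMem hmem, mul_zero, add_zero]
      exact div_le_self (hg0 y) (Real.one_le_rpow (not_lt.1 hxy) hs0)
  have hnn : ∀ y, 0 ≤ g y / ‖x - y‖ ^ s := fun y => div_nonneg (hg0 y) (by positivity)
  have hint : Integrable (fun y => g y / ‖x - y‖ ^ s) := by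
    refine hdom.mono' ?_ (Eventually.of_forall fun y => ?_)
    · simp only [div_eq_mul_inv]
      exact hg.aestronglyMeasurable.mul
        (by fun_prop : Measurable fun y => (‖x - y‖ ^ s)⁻¹).aestronglyMeasurable
    · rw [Real.norm_of_nonneg (hnn y)]
      exact hle y
  refine ⟨hint, (integral_mono hint hdom hle).trans_eq ?_⟩
  rw [integral_add hg ((hKi.comp_sub_left x).const_mul _), integral_const_mul,
    integral_sub_left_eq_self K volume x]

/-- Antilipschitz maps of Euclidean space push the volume forward to at most a multiple of it. -/
lemma map_volume_le_of_antilipschitz {n : ℕ}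
    {φ : EuclideanSpace ℝ (Fin n) → EuclideanSpace ℝ (Fin n)}
    {K : NNReal} (hφ : AntilipschitzWith K φ) (hm : Measurable φ) :
    Measure.map φ volume ≤ (K ^ n : NNReal) • (volume : Measure (EuclideanSpace ℝ (Fin n))) := by
  refine Measure.le_iff.2 fun s hs => ?_
  rw [Measure.map_apply hm hs]
  have h := hφ.hausdorffMeasure_preimage_le (d := n) (by positivity) s
  rw [Measure.isAddLeftInvariant_eq_smul (volume : Measure (EuclideanSpace ℝ (Fin n)))
    (Measure.hausdorffMeasure (n : ℝ))]
  simp only [Measure.smul_apply, ENNReal.smul_def, smul_eq_mul]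
  rw [mul_left_comm]
  refine mul_le_mul_right (h.trans_eq ?_) _
  simp

/-- A compactly supported vector field equal to the identity on the ball of radius `R`. -/
def cutoffField {n : ℕ} (R : ℝ) (x : EuclideanSpace ℝ (Fin n)) : EuclideanSpace ℝ (Fin n) :=
  max 0 (min 1 (2 * R / ‖x‖ - 1)) • x

lemma cutoffField_eq_self {n : ℕ} {R : ℝ} {x : EuclideanSpace ℝ (Fin n)} (hx : ‖x‖ ≤ R) :
    cutoffField R x = x := by
  rcases eq_or_ne x 0 with rfl | h0
  · simp [cutoffField]
  · have hpos : 0 < ‖x‖ := norm_pos_iff.2 h0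
    have h : 1 ≤ 2 * R / ‖x‖ - 1 := by
      rw [le_sub_iff_add_le, le_div_iff₀ hpos]
      linarith
    simp [cutoffField, min_eq_left h]

lemma cutoffField_eq_zero {n : ℕ} {R : ℝ} {x : EuclideanSpace ℝ (Fin n)} (hx : 2 * R ≤ ‖x‖) :
    cutoffField R x = 0 := by
  rcases eq_or_ne x 0 with rfl | h0
  · simp [cutoffField]
  · have hpos : 0 < ‖x‖ := norm_pos_iff.2 h0
    have h : 2 * R / ‖x‖ - 1 ≤ 0 := by
      rw [sub_nonpos, div_le_one hpos]
      exact hx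
    rw [cutoffField, max_eq_left ((min_le_right _ _).trans h), zero_smul]

lemma norm_cutoffField_le {n : ℕ} (R : ℝ) (x : EuclideanSpace ℝ (Fin n)) :
    ‖cutoffField R x‖ ≤ ‖x‖ := by
  rw [cutoffField, norm_smul, Real.norm_of_nonneg (le_max_left _ _)]
  exact mul_le_of_le_one_left (norm_nonneg _) (max_le zero_le_one (min_le_left _ _))

lemma norm_cutoffField_sub_le {n : ℕ} {R : ℝ} (hR : 0 < R) (x y : EuclideanSpace ℝ (Fin n)) :
    ‖cutoffField R x - cutoffField R y‖ ≤ ‖x - y‖ := by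
  have hcoef : ∀ z : EuclideanSpace ℝ (Fin n),
      max 0 (min 1 (2 * R / ‖z‖ - 1)) * ‖z‖ = max 0 (min ‖z‖ (2 * R - ‖z‖)) := by
    intro z
    rcases eq_or_ne z 0 with rfl | h0
    · simp [hR.le]
    · have hpos : 0 < ‖z‖ := norm_pos_iff.2 h0
      rw [max_mul_of_nonneg _ _ hpos.le, min_mul_of_nonneg _ _ hpos.le, sub_mul,
        div_mul_cancel₀ _ hpos.ne']
      simp
  have hψ : ∀ r s : ℝ,
      (max 0 (min r (2 * R - r)) - max 0 (min s (2 * R - s))) ^ 2 ≤ (r - s) ^ 2 := by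
    intro r s
    rw [sq_le_sq]
    rcases max_cases 0 (min r (2 * R - r)) with h1 | h1 <;>
    rcases max_cases 0 (min s (2 * R - s)) with h2 | h2 <;>
    rcases min_cases r (2 * R - r) with h3 | h3 <;>
    rcases min_cases s (2 * R - s) with h4 | h4 <;>
    rw [abs_le] <;> constructor <;> cases abs_cases (r - s) <;> linarith
  have hx := hcoef x
  have hy := hcoef y
  have hlip := hψ ‖x‖ ‖y‖
  rw [← hx, ← hy] at hlip
  have hcs := real_inner_le_norm x y
  unfold cutoffField
  set a := max 0 (min 1 (2 * R / ‖x‖ - 1)) with ha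
  set b := max 0 (min 1 (2 * R / ‖y‖ - 1)) with hb
  have ha0 : 0 ≤ a := le_max_left _ _
  have ha1 : a ≤ 1 := max_le zero_le_one (min_le_left _ _)
  have hb0 : 0 ≤ b := le_max_left _ _
  have hb1 : b ≤ 1 := max_le zero_le_one (min_le_left _ _)
  have hab : a * b ≤ 1 := mul_le_one₀ ha1 hb0 hb1
  refine le_of_sq_le_sq ?_ (norm_nonneg _)
  rw [norm_sub_sq_real, norm_sub_sq_real, norm_smul, norm_smul, real_inner_smul_left,
    real_inner_smul_right, Real.norm_of_nonneg ha0, Real.norm_of_nonneg hb0]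
  nlinarith [mul_nonneg (sub_nonneg.2 hab) (sub_nonneg.2 hcs)]

/-- A small contraction towards the origin, localized to the ball of radius `2 R`. -/
def shrink {n : ℕ} (R ε : ℝ) (x : EuclideanSpace ℝ (Fin n)) : EuclideanSpace ℝ (Fin n) :=
  x - ε • cutoffField R x

lemma shrink_sub_shrink {n : ℕ} (R ε : ℝ) (x y : EuclideanSpace ℝ (Fin n)) :
    shrink R ε x - shrink R ε y = (x - y) - ε • (cutoffField R x - cutoffField R y) := by
  simp only [shrink, smul_sub]
  abel

lemma le_norm_shrink_sub {n : ℕ} {R ε : ℝ} (hR : 0 < R) (hε : 0 ≤ ε)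
    (x y : EuclideanSpace ℝ (Fin n)) :
    (1 - ε) * ‖x - y‖ ≤ ‖shrink R ε x - shrink R ε y‖ := by
  rw [shrink_sub_shrink]
  have h := norm_sub_norm_le (x - y) (ε • (cutoffField R x - cutoffField R y))
  rw [norm_smul, Real.norm_of_nonneg hε] at h
  nlinarith [norm_cutoffField_sub_le hR x y]

lemma norm_shrink_sub_le {n : ℕ} {R ε : ℝ} (hR : 0 < R) (hε : 0 ≤ ε)
    (x y : EuclideanSpace ℝ (Fin n)) :
    ‖shrink R ε x - shrink R ε y‖ ≤ (1 + ε) * ‖x - y‖ := by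
  rw [shrink_sub_shrink]
  have h := norm_sub_le (x - y) (ε • (cutoffField R x - cutoffField R y))
  rw [norm_smul, Real.norm_of_nonneg hε] at h
  nlinarith [norm_cutoffField_sub_le hR x y]

lemma shrink_of_norm_le {n : ℕ} {R ε : ℝ} {x : EuclideanSpace ℝ (Fin n)} (hx : ‖x‖ ≤ R) :
    shrink R ε x = (1 - ε) • x := by
  rw [shrink, cutoffField_eq_self hx, sub_smul, one_smul]

lemma shrink_of_le_norm {n : ℕ} {R ε : ℝ} {x : EuclideanSpace ℝ (Fin n)} (hx : 2 * R ≤ ‖x‖) :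
    shrink R ε x = x := by
  rw [shrink, cutoffField_eq_zero hx, smul_zero, sub_zero]

lemma norm_shrink_le {n : ℕ} {R ε : ℝ} (hε0 : 0 ≤ ε) (hε1 : ε ≤ 1)
    {x : EuclideanSpace ℝ (Fin n)} : ‖shrink R ε x‖ ≤ ‖x‖ := by
  have hc0 : 0 ≤ max 0 (min 1 (2 * R / ‖x‖ - 1)) := le_max_left _ _
  have hc1 : max 0 (min 1 (2 * R / ‖x‖ - 1)) ≤ 1 := max_le zero_le_one (min_le_left _ _)
  have h : shrink R ε x = (1 - ε * max 0 (min 1 (2 * R / ‖x‖ - 1))) • x := by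
    rw [shrink, cutoffField, sub_smul, one_smul, mul_smul]
  have hprod := mul_le_one₀ hε1 hc0 hc1
  rw [h, norm_smul, Real.norm_of_nonneg (by linarith)]
  exact mul_le_of_le_one_left (norm_nonneg _) (by nlinarith [mul_nonneg hε0 hc0])

lemma continuous_cutoffField {n : ℕ} {R : ℝ} (hR : 0 < R) :
    Continuous (cutoffField R : EuclideanSpace ℝ (Fin n) → _) :=
  (LipschitzWith.of_dist_le_mul (K := 1) fun x y => by
    simpa [dist_eq_norm] using norm_cutoffField_sub_le hR x y).continuous

lemma continuous_shrink {n : ℕ} {R : ℝ} (hR : 0 < R) (ε : ℝ) :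
    Continuous (shrink R ε : EuclideanSpace ℝ (Fin n) → _) :=
  continuous_id.sub ((continuous_cutoffField hR).const_smul ε)

lemma map_shrink_prod_le {n : ℕ} {R ε : ℝ} (hR : 0 < R) (hε0 : 0 ≤ ε) (hε1 : ε < 1) :
    Measure.map (Prod.map (shrink R ε) (shrink R ε))
      (volume : Measure (EuclideanSpace ℝ (Fin n) × EuclideanSpace ℝ (Fin n))) ≤
      (Real.toNNReal (((1 - ε) ^ (2 * n))⁻¹)) •
        (volume : Measure (EuclideanSpace ℝ (Fin n) × EuclideanSpace ℝ (Fin n))) := by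
  have hpos : 0 < 1 - ε := by linarith
  have hanti : AntilipschitzWith (Real.toNNReal (1 - ε)⁻¹)
      (shrink R ε : EuclideanSpace ℝ (Fin n) → _) := by
    refine AntilipschitzWith.of_le_mul_dist fun x y => ?_
    rw [Real.coe_toNNReal _ (by positivity), dist_eq_norm, dist_eq_norm, inv_mul_eq_div,
      le_div_iff₀ hpos, mul_comm]
    exact le_norm_shrink_sub hR hε0 x y
  have hm := (continuous_shrink (n := n) hR ε).measurable
  have hle := map_volume_le_of_antilipschitz hanti hm
  rw [Measure.volume_eq_prod, ← Measure.map_prod_map _ _ hm hm]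
  refine (Measure.prod_mono hle hle).trans_eq ?_
  simp only [Measure.prod_smul_left, Measure.prod_smul_right, smul_smul]
  congr 1
  rw [← pow_add, ← two_mul, ← Real.toNNReal_pow (by positivity), inv_pow]

/-- The conformal weight `e^{((2n-μ)/2) u}`. -/
def weight (n : ℕ) (μ : ℝ) (u : EuclideanSpace ℝ (Fin n) → ℝ) (x : EuclideanSpace ℝ (Fin n)) : ℝ :=
  Real.exp ((2 * n - μ) / 2 * u x)

/-- The density `v e^{((2n-μ)/2) u}`. -/
def density (n : ℕ) (μ : ℝ) (u : EuclideanSpace ℝ (Fin n) → ℝ) (x : EuclideanSpace ℝ (Fin n)) : ℝ :=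
  V n μ u x * weight n μ u x

/-- The interaction `e^{((2n-μ)/2) (u(x) + u(y))} / |x-y|^μ`. -/
def interaction (n : ℕ) (μ : ℝ) (u : EuclideanSpace ℝ (Fin n) → ℝ)
    (q : EuclideanSpace ℝ (Fin n) × EuclideanSpace ℝ (Fin n)) : ℝ :=
  weight n μ u q.1 * weight n μ u q.2 / ‖q.1 - q.2‖ ^ μ

section Basic

variable {n : ℕ} {μ : ℝ} {u : EuclideanSpace ℝ (Fin n) → ℝ}

lemma weight_pos (x : EuclideanSpace ℝ (Fin n)) : 0 < weight n μ u x := Real.exp_pos _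

lemma V_nonneg (x : EuclideanSpace ℝ (Fin n)) : 0 ≤ V n μ u x :=
  integral_nonneg fun _ => div_nonneg (Real.exp_pos _).le (by positivity)

lemma density_nonneg (x : EuclideanSpace ℝ (Fin n)) : 0 ≤ density n μ u x :=
  mul_nonneg (V_nonneg x) (weight_pos x).le

lemma interaction_nonneg (q : EuclideanSpace ℝ (Fin n) × EuclideanSpace ℝ (Fin n)) :
    0 ≤ interaction n μ u q :=
  div_nonneg (mul_nonneg (weight_pos _).le (weight_pos _).le) (by positivity)

lemma interaction_swap (q : EuclideanSpace ℝ (Fin n) × EuclideanSpace ℝ (Fin n)) :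
    interaction n μ u q.swap = interaction n μ u q := by
  simp only [interaction, Prod.fst_swap, Prod.snd_swap, norm_sub_rev q.2 q.1,
    mul_comm (weight n μ u q.2)]

lemma integral_interaction_right (x : EuclideanSpace ℝ (Fin n)) :
    ∫ y, interaction n μ u (x, y) = density n μ u x := by
  simp only [interaction, density, V, mul_div_assoc]
  rw [integral_const_mul, mul_comm]
  rfl

lemma continuous_weight (hu : Continuous u) : Continuous (weight n μ u) := by
  unfold weight
  fun_prop

lemma integrable_density (hW : Integrable (interaction n μ u)) : Integrable (density n μ u) := by
  have h := Integrable.integral_prod_left (f := interaction n μ u) hW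
  simpa only [integral_interaction_right] using h

lemma integral_interaction (hW : Integrable (interaction n μ u)) :
    ∫ q, interaction n μ u q = ∫ x, density n μ u x := by
  rw [Measure.volume_eq_prod, integral_prod _ hW]
  simp only [integral_interaction_right]

lemma integrable_fst_mul_interaction (hW : Integrable (interaction n μ u))
    {a : EuclideanSpace ℝ (Fin n) → ℝ} (ham : Measurable a) {B : ℝ} (ha : ∀ x, |a x| ≤ B) :
    Integrable (fun q => a q.1 * interaction n μ u q) :=
  hW.bdd_mul (ham.comp measurable_fst).aestronglyMeasurable
    (Eventually.of_forall fun q => ha q.1)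

lemma integral_fst_mul_interaction (hW : Integrable (interaction n μ u))
    {a : EuclideanSpace ℝ (Fin n) → ℝ} (ham : Measurable a) {B : ℝ} (ha : ∀ x, |a x| ≤ B) :
    ∫ q, a q.1 * interaction n μ u q = ∫ x, a x * density n μ u x := by
  rw [Measure.volume_eq_prod, integral_prod _ (integrable_fst_mul_interaction hW ham ha)]
  simp only [integral_const_mul, integral_interaction_right]

lemma integrable_snd_mul_interaction (hW : Integrable (interaction n μ u))
    {a : EuclideanSpace ℝ (Fin n) → ℝ} (ham : Measurable a) {B : ℝ} (ha : ∀ x, |a x| ≤ B) :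
    Integrable (fun q => a q.2 * interaction n μ u q) := by
  have h := (integrable_fst_mul_interaction hW ham ha).swap
  simp only [Function.comp_def, interaction_swap, Prod.fst_swap] at h
  exact h

lemma integral_snd_mul_interaction (hW : Integrable (interaction n μ u))
    {a : EuclideanSpace ℝ (Fin n) → ℝ} (ham : Measurable a) {B : ℝ} (ha : ∀ x, |a x| ≤ B) :
    ∫ q, a q.2 * interaction n μ u q = ∫ x, a x * density n μ u x := by
  rw [← integral_fst_mul_interaction hW ham ha, Measure.volume_eq_prod,
    ← integral_prod_swap (fun q => a q.1 * interaction n μ u q)]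
  simp only [interaction_swap, Prod.fst_swap]

/-- Comparing the interaction energy with that of a localized contraction. -/
lemma integral_interaction_comp_shrink_le (hW : Integrable (interaction n μ u)) {R ε : ℝ}
    (hR : 0 < R) (hε0 : 0 ≤ ε) (hε1 : ε < 1) :
    Integrable (fun q : EuclideanSpace ℝ (Fin n) × EuclideanSpace ℝ (Fin n) =>
        interaction n μ u (shrink R ε q.1, shrink R ε q.2)) ∧
      (1 - ε) ^ (2 * n) * ∫ q : EuclideanSpace ℝ (Fin n) × EuclideanSpace ℝ (Fin n),
        interaction n μ u (shrink R ε q.1, shrink R ε q.2) ≤ ∫ x, density n μ u x := by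
  have hpos : 0 < (1 - ε) ^ (2 * n) := pow_pos (by linarith) _
  let c := Real.toNNReal (((1 - ε) ^ (2 * n))⁻¹)
  have hmap := map_shrink_prod_le (n := n) hR hε0 hε1
  have hΦ : Measurable (Prod.map (shrink R ε : EuclideanSpace ℝ (Fin n) → _)
      (shrink R ε : EuclideanSpace ℝ (Fin n) → _)) :=
    (continuous_shrink hR ε).measurable.prodMap (continuous_shrink hR ε).measurable
  have hWc : Integrable (interaction n μ u) (c • volume) := hW.smul_measure_nnreal
  have hWm := hWc.mono_measure hmap
  refine ⟨(integrable_map_measure hWm.aestronglyMeasurable hΦ.aemeasurable).1 hWm, ?_⟩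
  have h1 : ∫ q : EuclideanSpace ℝ (Fin n) × EuclideanSpace ℝ (Fin n),
      interaction n μ u (shrink R ε q.1, shrink R ε q.2) =
      ∫ q, interaction n μ u q ∂(Measure.map (Prod.map (shrink R ε) (shrink R ε)) volume) :=
    (integral_map hΦ.aemeasurable hWm.aestronglyMeasurable).symm
  have h2 := integral_mono_measure hmap (Eventually.of_forall interaction_nonneg) hWc
  rw [integral_smul_nnreal_measure, integral_interaction hW, NNReal.smul_def, smul_eq_mul,
    Real.coe_toNNReal _ (by positivity)] at h2
  rw [h1]
  calc _ ≤ (1 - ε) ^ (2 * n) * (((1 - ε) ^ (2 * n))⁻¹ * ∫ x, density n μ u x) := by gcongr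
    _ = _ := by rw [← mul_assoc, mul_inv_cancel₀ hpos.ne', one_mul]

end Basic

/-- Indicator of the complement of the closed ball of radius `R`. -/
def outside {n : ℕ} (R : ℝ) : EuclideanSpace ℝ (Fin n) → ℝ :=
  (closedBall 0 R)ᶜ.indicator 1

lemma outside_of_le {n : ℕ} {R : ℝ} {x : EuclideanSpace ℝ (Fin n)} (hx : ‖x‖ ≤ R) :
    outside R x = 0 := by
  simp [outside, hx]

lemma outside_of_lt {n : ℕ} {R : ℝ} {x : EuclideanSpace ℝ (Fin n)} (hx : R < ‖x‖) :
    outside R x = 1 := by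
  simp [outside, hx]

lemma outside_nonneg {n : ℕ} (R : ℝ) (x : EuclideanSpace ℝ (Fin n)) : 0 ≤ outside R x :=
  Set.indicator_nonneg (fun _ _ => zero_le_one) x

lemma outside_le_one {n : ℕ} (R : ℝ) (x : EuclideanSpace ℝ (Fin n)) : outside R x ≤ 1 :=
  Set.indicator_le_self' (fun _ _ => zero_le_one) x

lemma measurable_outside {n : ℕ} (R : ℝ) :
    Measurable (outside R : EuclideanSpace ℝ (Fin n) → ℝ) :=
  measurable_one.indicator isClosed_closedBall.measurableSet.compl

lemma norm_shrink_sub_le_exp {n : ℕ} {R ε : ℝ} (hR : 0 < R) (hε0 : 0 ≤ ε) (hε1 : ε ≤ 1 / 4)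
    (x y : EuclideanSpace ℝ (Fin n)) :
    ‖shrink R ε x - shrink R ε y‖ ≤
      (1 - ε) * Real.exp (3 * ε * (outside R x + outside R y)) * ‖x - y‖ := by
  by_cases hxy : ‖x‖ ≤ R ∧ ‖y‖ ≤ R
  · rw [outside_of_le hxy.1, outside_of_le hxy.2, shrink_of_norm_le hxy.1,
      shrink_of_norm_le hxy.2, ← smul_sub, norm_smul, Real.norm_of_nonneg (by linarith)]
    simp
  · refine (norm_shrink_sub_le hR hε0 x y).trans ?_
    gcongr
    have h1 : 1 ≤ outside R x + outside R y := by
      rcases not_and_or.1 hxy with h | h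
      · rw [outside_of_lt (not_le.1 h)]
        linarith [outside_nonneg R y]
      · rw [outside_of_lt (not_le.1 h)]
        linarith [outside_nonneg R x]
    have h2 : 3 * ε + 1 ≤ Real.exp (3 * ε * (outside R x + outside R y)) :=
      (Real.add_one_le_exp _).trans
        (Real.exp_le_exp.2 (le_mul_of_one_le_right (by positivity) h1))
    nlinarith

/-- Linearization of the interaction under a localized contraction. -/
lemma interaction_mul_le {n : ℕ} {μ : ℝ} {u : EuclideanSpace ℝ (Fin n) → ℝ} (hμ0 : 0 < μ)
    {R ε : ℝ} (hR : 0 < R) (hε0 : 0 ≤ ε) (hε1 : ε ≤ 1 / 4)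
    {a : EuclideanSpace ℝ (Fin n) → ℝ}
    (ha : ∀ x, a x = (2 * n - μ) / 2 * (u (shrink R ε x) - u x)
      + (2 * n - μ) / 2 * Real.log (1 - ε) - 3 * μ * ε * outside R x)
    (q : EuclideanSpace ℝ (Fin n) × EuclideanSpace ℝ (Fin n)) :
    interaction n μ u q + a q.1 * interaction n μ u q + a q.2 * interaction n μ u q ≤
      (1 - ε) ^ (2 * n) * interaction n μ u (shrink R ε q.1, shrink R ε q.2) := by
  obtain ⟨x, y⟩ := q
  have hpos : 0 < 1 - ε := by linarith
  rcases eq_or_ne x y with rfl | hne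
  · simp [interaction, Real.zero_rpow hμ0.ne']
  have hd : 0 < ‖x - y‖ := norm_pos_iff.2 (sub_ne_zero.2 hne)
  have hd' : 0 < ‖shrink R ε x - shrink R ε y‖ :=
    (mul_pos hpos hd).trans_le (le_norm_shrink_sub hR hε0 x y)
  have hup := norm_shrink_sub_le_exp hR hε0 hε1 x y
  have hW := interaction_nonneg (n := n) (μ := μ) (u := u) (x, y)
  have hexp : interaction n μ u (x, y) * Real.exp (a x + a y) ≤
      (1 - ε) ^ (2 * n) * interaction n μ u (shrink R ε x, shrink R ε y) := by
    have hkey : Real.log ‖shrink R ε x - shrink R ε y‖ ≤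
        Real.log (1 - ε) + 3 * ε * (outside R x + outside R y) + Real.log ‖x - y‖ := by
      refine (Real.log_le_log hd' hup).trans_eq ?_
      rw [Real.log_mul (by positivity) hd.ne', Real.log_mul hpos.ne' (Real.exp_pos _).ne',
        Real.log_exp]
    have e1 : ∀ z : ℝ, 0 < z → (z ^ μ)⁻¹ = Real.exp (-(μ * Real.log z)) := by
      intro z hz
      rw [Real.exp_neg, mul_comm, Real.rpow_def_of_pos hz]
    have e2 : (1 - ε) ^ (2 * n) = Real.exp (2 * n * Real.log (1 - ε)) := by
      rw [← Real.rpow_natCast, Real.rpow_def_of_pos hpos, mul_comm]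
      push_cast
      rfl
    simp only [interaction, weight, div_eq_mul_inv]
    rw [e1 _ hd, e1 _ hd', e2]
    simp only [← Real.exp_add, ha]
    refine Real.exp_le_exp.2 ?_
    nlinarith [mul_le_mul_of_nonneg_left hkey hμ0.le]
  refine le_trans ?_ hexp
  nlinarith [mul_le_mul_of_nonneg_left (Real.add_one_le_exp (a x + a y)) hW]

/-- The first variation inequality coming from dilation invariance of the interaction energy. -/
lemma integral_shrink_variation_le {n : ℕ} {μ : ℝ} {u : EuclideanSpace ℝ (Fin n) → ℝ}
    (hμ0 : 0 < μ) (hu : Continuous u) (hW : Integrable (interaction n μ u))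
    {R ε : ℝ} (hR : 0 < R) (hε0 : 0 ≤ ε) (hε1 : ε ≤ 1 / 4) :
    Integrable (fun x => (u (shrink R ε x) - u x) * density n μ u x) ∧
    (2 * n - μ) / 2 * ∫ x, (u (shrink R ε x) - u x) * density n μ u x ≤
      3 * μ * ε * (∫ x, outside R x * density n μ u x)
        - (2 * n - μ) / 2 * Real.log (1 - ε) * ∫ x, density n μ u x := by
  have hG := integrable_density hW
  have hδc : Continuous fun x => u (shrink R ε x) - u x :=
    (hu.comp (continuous_shrink hR ε)).sub hu
  obtain ⟨D, hD⟩ : ∃ D, ∀ x, |u (shrink R ε x) - u x| ≤ D := by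
    refine (hδc.norm.bddAbove_range_of_hasCompactSupport ?_).imp fun D hD x => hD ⟨x, rfl⟩
    refine HasCompactSupport.intro (isCompact_closedBall 0 (2 * R)) fun x hx => ?_
    rw [shrink_of_le_norm (by simpa using (not_le.1 (by simpa using hx)).le), sub_self, norm_zero]
  have hδG : Integrable (fun x => (u (shrink R ε x) - u x) * density n μ u x) :=
    hG.bdd_mul hδc.aestronglyMeasurable (Eventually.of_forall hD)
  have hoG : Integrable (fun x => outside R x * density n μ u x) :=
    hG.bdd_mul (measurable_outside R).aestronglyMeasurable (Eventually.of_forall fun x => by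
      rw [Real.norm_of_nonneg (outside_nonneg R x)]
      exact outside_le_one R x)
  refine ⟨hδG, ?_⟩
  set p : ℝ := (2 * n - μ) / 2 with hp
  set a : EuclideanSpace ℝ (Fin n) → ℝ := fun x => p * (u (shrink R ε x) - u x)
      + p * Real.log (1 - ε) - 3 * μ * ε * outside R x with ha
  have ham : Measurable a :=
    ((hδc.measurable.const_mul p).add_const _).sub ((measurable_outside R).const_mul _)
  have hab : ∀ x, |a x| ≤ |p| * D + |p * Real.log (1 - ε)| + 3 * μ * ε := by
    intro x
    have h1 : |p * (u (shrink R ε x) - u x)| ≤ |p| * D := by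
      rw [abs_mul]
      exact mul_le_mul_of_nonneg_left (hD x) (abs_nonneg p)
    have h2 : |3 * μ * ε * outside R x| ≤ 3 * μ * ε := by
      rw [abs_of_nonneg (mul_nonneg (by positivity) (outside_nonneg R x))]
      exact mul_le_of_le_one_right (by positivity) (outside_le_one R x)
    calc |a x| ≤ |p * (u (shrink R ε x) - u x) + p * Real.log (1 - ε)|
          + |3 * μ * ε * outside R x| := abs_sub _ _
      _ ≤ _ := add_le_add ((abs_add_le _ _).trans (add_le_add h1 le_rfl)) h2
  obtain ⟨hWi, hWle⟩ := integral_interaction_comp_shrink_le hW hR hε0 (by linarith)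
  have h1 := integrable_fst_mul_interaction hW ham hab
  have h2 := integrable_snd_mul_interaction hW ham hab
  have hmono := integral_mono ((hW.add h1).add h2) (hWi.const_mul ((1 - ε) ^ (2 * n)))
    (fun q => interaction_mul_le hμ0 hR hε0 hε1 (fun x => rfl) q)
  simp only [Pi.add_apply] at hmono
  have h12 : Integrable (fun q => interaction n μ u q + a q.1 * interaction n μ u q) := hW.add h1
  rw [integral_add h12 h2, integral_add hW h1, integral_interaction hW,
    integral_fst_mul_interaction hW ham hab, integral_snd_mul_interaction hW ham hab,
    integral_const_mul] at hmono
  have hsplit : ∫ x, a x * density n μ u x = p * (∫ x, (u (shrink R ε x) - u x) * density n μ u x)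
      + p * Real.log (1 - ε) * (∫ x, density n μ u x)
      - 3 * μ * ε * ∫ x, outside R x * density n μ u x := by
    have h3 : Integrable (fun x => p * ((u (shrink R ε x) - u x) * density n μ u x)
        + p * Real.log (1 - ε) * density n μ u x) := (hδG.const_mul _).add (hG.const_mul _)
    rw [← integral_const_mul, ← integral_const_mul, ← integral_const_mul,
      ← integral_add (hδG.const_mul _) (hG.const_mul _), ← integral_sub h3 (hoG.const_mul _)]
    refine integral_congr_ae (Eventually.of_forall fun x => ?_)
    simp only [ha]
    ring
  linarith

lemma log_one_add_sq_le {s : ℝ} (hs : 0 ≤ s) :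
    Real.log (1 + s ^ 2) ≤ 4 / 3 * s ^ (3 / 2 : ℝ) := by
  have h1 : (1 + s ^ 2) ^ (3 / 4 : ℝ) ≤ 1 + s ^ (3 / 2 : ℝ) := by
    refine (Real.rpow_add_le_add_rpow zero_le_one (sq_nonneg s) (by norm_num)
      (by norm_num)).trans_eq ?_
    rw [Real.one_rpow, ← Real.rpow_natCast, ← Real.rpow_mul hs]
    norm_num
  have h2 : 3 / 4 * Real.log (1 + s ^ 2) ≤ s ^ (3 / 2 : ℝ) := by
    rw [← Real.log_rpow (by positivity)]
    have := Real.log_le_sub_one_of_pos (x := (1 + s ^ 2) ^ (3 / 4 : ℝ)) (by positivity)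
    linarith
  linarith

/-- Symmetrized second-order estimate for the logarithmic kernel. -/
lemma symm_log_sub_ge {n : ℕ} {x y a b : EuclideanSpace ℝ (Fin n)} {κ ε : ℝ} (hxy : x ≠ y)
    (hκ : κ * ‖x - y‖ ^ 2 ≤ inner ℝ (x - y) (a - b)) (hκ1 : κ ≤ 1)
    (hε0 : 0 ≤ ε) (hε1 : ε ≤ 1 / 2) (hx : x - ε • a ≠ y) (hy : y - ε • b ≠ x) :
    ε * κ - 4 / 3 * ((ε * (‖a‖ / ‖x - y‖)) ^ (3 / 2 : ℝ) + (ε * (‖b‖ / ‖x - y‖)) ^ (3 / 2 : ℝ)) ≤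
      (Real.log ‖x - y‖ - Real.log ‖x - ε • a - y‖)
        + (Real.log ‖y - x‖ - Real.log ‖y - ε • b - x‖) := by
  have hd : 0 < ‖x - y‖ := norm_pos_iff.2 (sub_ne_zero.2 hxy)
  have h1 : 0 < ‖x - ε • a - y‖ := norm_pos_iff.2 (sub_ne_zero.2 hx)
  have h2 : 0 < ‖y - ε • b - x‖ := norm_pos_iff.2 (sub_ne_zero.2 hy)
  set d := ‖x - y‖ with hd_def
  set s := ε * (‖a‖ / d) with hs
  set t := ε * (‖b‖ / d) with ht
  have hs0 : 0 ≤ s := by positivity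
  have ht0 : 0 ≤ t := by positivity
  have e1 : ‖x - ε • a - y‖ ^ 2 = d ^ 2 - 2 * ε * inner ℝ (x - y) a + (s * d) ^ 2 := by
    rw [show x - ε • a - y = (x - y) - ε • a by abel, norm_sub_sq_real, norm_smul,
      real_inner_smul_right, Real.norm_of_nonneg hε0, hs, ← hd_def]
    field_simp
  have e2 : ‖y - ε • b - x‖ ^ 2 = d ^ 2 + 2 * ε * inner ℝ (x - y) b + (t * d) ^ 2 := by
    rw [← norm_neg, show -(y - ε • b - x) = (x - y) + ε • b by abel, norm_add_sq_real, norm_smul,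
      real_inner_smul_right, Real.norm_of_nonneg hε0, ht, ← hd_def]
    field_simp
  rw [inner_sub_right] at hκ
  have hprod : ‖x - ε • a - y‖ * ‖y - ε • b - x‖ ≤
      d ^ 2 * (Real.exp (-(ε * κ)) * ((1 + s ^ 2) * (1 + t ^ 2))) := by
    have ham : ‖x - ε • a - y‖ * ‖y - ε • b - x‖ ≤
        d ^ 2 * ((1 - ε * κ) + (s ^ 2 + t ^ 2) / 2) := by
      nlinarith [sq_nonneg (‖x - ε • a - y‖ - ‖y - ε • b - x‖),
        mul_le_mul_of_nonneg_left hκ hε0]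
    refine ham.trans (mul_le_mul_of_nonneg_left ?_ (sq_nonneg d))
    have hexp : 1 - ε * κ ≤ Real.exp (-(ε * κ)) := by
      linarith [Real.add_one_le_exp (-(ε * κ))]
    have hhalf : 1 / 2 ≤ 1 - ε * κ := by nlinarith
    have hst : (s ^ 2 + t ^ 2) / 2 ≤ (1 - ε * κ) * (s ^ 2 + t ^ 2) := by
      nlinarith [sq_nonneg s, sq_nonneg t]
    calc (1 - ε * κ) + (s ^ 2 + t ^ 2) / 2 ≤ (1 - ε * κ) * ((1 + s ^ 2) * (1 + t ^ 2)) := by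
          nlinarith [mul_nonneg (sq_nonneg s) (sq_nonneg t)]
      _ ≤ _ := by gcongr
  have hlog := Real.log_le_log (mul_pos h1 h2) hprod
  rw [Real.log_mul h1.ne' h2.ne', Real.log_mul (by positivity) (by positivity), Real.log_pow,
    Real.log_mul (by positivity) (by positivity), Real.log_exp,
    Real.log_mul (by positivity) (by positivity)] at hlog
  rw [norm_sub_rev y x, ← hd_def]
  push_cast at hlog
  linarith [log_one_add_sq_le hs0, log_one_add_sq_le ht0]

lemma abs_log_sub_log_le {a b : ℝ} (ha : 0 < a) (hb : 0 < b) :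
    |Real.log a - Real.log b| ≤ |a - b| * (1 / a + 1 / b) := by
  have h : ∀ s t : ℝ, 0 < s → 0 < t → Real.log s - Real.log t ≤ |s - t| * (1 / s + 1 / t) := by
    intro s t hs ht
    rw [← Real.log_div hs.ne' ht.ne']
    have h1 := Real.log_le_sub_one_of_pos (div_pos hs ht)
    have h2 : s / t - 1 ≤ |s - t| * (1 / t) := by
      rw [show s / t - 1 = (s - t) * (1 / t) by field_simp]
      gcongr
      exact le_abs_self _
    have h3 : 0 ≤ |s - t| * (1 / s) := by positivity
    linarith
  rw [abs_le]
  constructor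
  · have := h b a hb ha
    rw [abs_sub_comm, add_comm (1 / b)] at this
    linarith
  · exact h a b ha hb

section LogPotential

variable {n : ℕ} {G : EuclideanSpace ℝ (Fin n) → ℝ}

lemma integrable_mul_prod_of_bound (hG0 : ∀ x, 0 ≤ G x) (hG : Integrable G)
    {k : EuclideanSpace ℝ (Fin n) × EuclideanSpace ℝ (Fin n) → ℝ} (hk : Measurable k) {C : ℝ}
    (hC : ∀ x, Integrable (fun y => k (x, y) * G y) ∧ ∫ y, |k (x, y)| * G y ≤ C) :
    Integrable (fun q => k q * (G q.1 * G q.2)) := by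
  have hmeas : AEStronglyMeasurable
      (fun q : EuclideanSpace ℝ (Fin n) × EuclideanSpace ℝ (Fin n) => k q * (G q.1 * G q.2))
      (volume.prod volume) :=
    hk.aestronglyMeasurable.mul (hG.aestronglyMeasurable.comp_fst.mul
      hG.aestronglyMeasurable.comp_snd)
  refine (integrable_prod_iff hmeas).2 ⟨Eventually.of_forall fun x => ?_, ?_⟩
  · refine ((hC x).1.const_mul (G x)).congr (Eventually.of_forall fun y => ?_)
    simp only
    ring
  · refine (hG.const_mul C).mono' hmeas.norm.integral_prod_right' (Eventually.of_forall fun x => ?_)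
    have he : ∀ y, ‖k (x, y) * (G x * G y)‖ = G x * (|k (x, y)| * G y) := by
      intro y
      rw [norm_mul, norm_mul, Real.norm_of_nonneg (hG0 x), Real.norm_of_nonneg (hG0 y),
        Real.norm_eq_abs]
      ring
    simp only [he]
    rw [integral_const_mul, Real.norm_of_nonneg (mul_nonneg (hG0 x)
      (integral_nonneg fun y => mul_nonneg (abs_nonneg _) (hG0 y))), mul_comm C]
    exact mul_le_mul_of_nonneg_left (hC x).2 (hG0 x)

lemma norm_sub_le_one_add_mul (x y : EuclideanSpace ℝ (Fin n)) :
    ‖x - y‖ ≤ (1 + ‖x‖) * (‖y‖ + 1) := by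
  nlinarith [norm_sub_le x y, norm_nonneg x, norm_nonneg y,
    mul_nonneg (norm_nonneg x) (norm_nonneg y)]

lemma abs_log_ratio_le {x y : EuclideanSpace ℝ (Fin n)} (hxy : x ≠ y) :
    |Real.log ((‖y‖ + 1) / ‖x - y‖)| ≤ Real.log (1 + ‖x‖) + (‖x‖ + 1) / ‖x - y‖ := by
  have hd : 0 < ‖x - y‖ := norm_pos_iff.2 (sub_ne_zero.2 hxy)
  have hlog0 : 0 ≤ Real.log (1 + ‖x‖) := Real.log_nonneg (by linarith [norm_nonneg x])
  rw [Real.log_div (by positivity) hd.ne', abs_le]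
  constructor
  · have h : ‖x - y‖ ≤ (1 + ‖x‖) * (‖y‖ + 1) :=
      norm_sub_le_one_add_mul x y
    have h' := Real.log_le_log hd h
    rw [Real.log_mul (by positivity) (by positivity)] at h'
    have : 0 ≤ (‖x‖ + 1) / ‖x - y‖ := by positivity
    linarith
  · have h1 : (‖y‖ + 1) / ‖x - y‖ ≤ 1 + (‖x‖ + 1) / ‖x - y‖ := by
      rw [div_le_iff₀ hd, add_mul, div_mul_cancel₀ _ hd.ne']
      have := norm_sub_norm_le y x
      rw [norm_sub_rev] at this
      linarith
    have h2 := Real.log_le_sub_one_of_pos (x := (‖y‖ + 1) / ‖x - y‖) (by positivity)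
    rw [Real.log_div (by positivity) hd.ne'] at h2
    linarith

lemma ae_ne_of_two_le (hn : 2 ≤ n) (x : EuclideanSpace ℝ (Fin n)) :
    ∀ᵐ y : EuclideanSpace ℝ (Fin n), x ≠ y := by
  have : Nonempty (Fin n) := ⟨⟨0, by omega⟩⟩
  filter_upwards [(measure_singleton x : volume {x} = 0) |> compl_mem_ae_iff.2] with y hy h
  exact hy h.symm

variable (hn : 2 ≤ n) (hG0 : ∀ x, 0 ≤ G x) (hG : Integrable G)
  (hGb : ∀ r : ℝ, ∃ B, ∀ x, ‖x‖ ≤ r → G x ≤ B)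
include hn hG0 hG hGb

lemma exists_newton_bound (r : ℝ) : ∃ C, ∀ x, ‖x‖ ≤ r → Integrable (fun y => G y / ‖x - y‖) ∧
    ∫ y, G y / ‖x - y‖ ≤ C := by
  have hn' : (2 : ℝ) ≤ n := by exact_mod_cast hn
  simpa only [Real.rpow_one] using
    exists_riesz_bound (by omega) (zero_le_one) (by linarith) hG0 hG hGb r

lemma integrable_log_ratio_mul (x : EuclideanSpace ℝ (Fin n)) :
    Integrable (fun y => Real.log ((‖y‖ + 1) / ‖x - y‖) * G y) := by
  obtain ⟨C, hC⟩ := exists_newton_bound hn hG0 hG hGb ‖x‖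
  have h := (hC x le_rfl).1
  refine ((hG.const_mul (Real.log (1 + ‖x‖))).add (h.const_mul (‖x‖ + 1))).mono' ?_ ?_
  · have hm : Measurable fun y => Real.log ((‖y‖ + 1) / ‖x - y‖) := by fun_prop
    exact hm.aestronglyMeasurable.mul hG.aestronglyMeasurable
  · filter_upwards [ae_ne_of_two_le hn x] with y hy
    rw [norm_mul, Real.norm_of_nonneg (hG0 y), Real.norm_eq_abs]
    refine (mul_le_mul_of_nonneg_right (abs_log_ratio_le hy) (hG0 y)).trans_eq ?_
    simp only [Pi.add_apply]
    ring

lemma integral_log_ratio_sub (x z : EuclideanSpace ℝ (Fin n)) :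
    (∫ y, Real.log ((‖y‖ + 1) / ‖z - y‖) * G y) - (∫ y, Real.log ((‖y‖ + 1) / ‖x - y‖) * G y) =
      ∫ y, (Real.log ‖x - y‖ - Real.log ‖z - y‖) * G y := by
  rw [← integral_sub (integrable_log_ratio_mul hn hG0 hG hGb z)
    (integrable_log_ratio_mul hn hG0 hG hGb x)]
  refine integral_congr_ae ?_
  filter_upwards [ae_ne_of_two_le hn x, ae_ne_of_two_le hn z] with y hx hz
  rw [Real.log_div (by positivity) (norm_ne_zero_iff.2 (sub_ne_zero.2 hx)),
    Real.log_div (by positivity) (norm_ne_zero_iff.2 (sub_ne_zero.2 hz))]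
  ring

lemma integral_log_ratio_ge (x : EuclideanSpace ℝ (Fin n)) :
    -(Real.log (1 + ‖x‖) * ∫ y, G y) ≤ ∫ y, Real.log ((‖y‖ + 1) / ‖x - y‖) * G y := by
  rw [← neg_mul, ← integral_const_mul]
  refine integral_mono_ae (hG.const_mul _) (integrable_log_ratio_mul hn hG0 hG hGb x) ?_
  filter_upwards [ae_ne_of_two_le hn x] with y hy
  refine mul_le_mul_of_nonneg_right ?_ (hG0 y)
  have hd : 0 < ‖x - y‖ := norm_pos_iff.2 (sub_ne_zero.2 hy)
  have h : ‖x - y‖ ≤ (1 + ‖x‖) * (‖y‖ + 1) :=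
    norm_sub_le_one_add_mul x y
  have h' := Real.log_le_log hd h
  rw [Real.log_mul (by positivity) (by positivity)] at h'
  rw [Real.log_div (by positivity) hd.ne']
  linarith

end LogPotential

section Dilation

variable {n : ℕ} {G : EuclideanSpace ℝ (Fin n) → ℝ}

/-- The first variation of the logarithmic kernel along `shrink R ε`. -/
def logVariation (R ε : ℝ) (q : EuclideanSpace ℝ (Fin n) × EuclideanSpace ℝ (Fin n)) : ℝ :=
  Real.log ‖q.1 - q.2‖ - Real.log ‖shrink R ε q.1 - q.2‖

lemma measurable_logVariation {R : ℝ} (hR : 0 < R) (ε : ℝ) :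
    Measurable (logVariation R ε :
      EuclideanSpace ℝ (Fin n) × EuclideanSpace ℝ (Fin n) → ℝ) := by
  have h := (continuous_shrink (n := n) hR ε).measurable
  unfold logVariation
  fun_prop

lemma ae_ne_comp_fst (hn : 2 ≤ n) {φ : EuclideanSpace ℝ (Fin n) → EuclideanSpace ℝ (Fin n)}
    (hφ : Continuous φ) :
    ∀ᵐ q : EuclideanSpace ℝ (Fin n) × EuclideanSpace ℝ (Fin n), φ q.1 ≠ q.2 := by
  have hopen : MeasurableSet {q : EuclideanSpace ℝ (Fin n) × EuclideanSpace ℝ (Fin n) |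
      φ q.1 ≠ q.2} :=
    (isOpen_ne_fun (hφ.comp continuous_fst) continuous_snd).measurableSet
  exact (Measure.ae_prod_iff_ae_ae hopen).2
    (Eventually.of_forall fun x => ae_ne_of_two_le hn (φ x))

lemma cutoffField_sub_inner_ge {R : ℝ} (hR : 0 < R) (x y : EuclideanSpace ℝ (Fin n)) :
    ∃ κ : ℝ, 1 - 2 * (outside R x + outside R y) ≤ κ ∧ κ ≤ 1 ∧
      κ * ‖x - y‖ ^ 2 ≤ inner ℝ (x - y) (cutoffField R x - cutoffField R y) := by
  by_cases hxy : ‖x‖ ≤ R ∧ ‖y‖ ≤ R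
  · refine ⟨1, ?_, le_rfl, ?_⟩
    · rw [outside_of_le hxy.1, outside_of_le hxy.2]
      norm_num
    · rw [cutoffField_eq_self hxy.1, cutoffField_eq_self hxy.2, real_inner_self_eq_norm_sq, one_mul]
  · refine ⟨-1, ?_, by norm_num, ?_⟩
    · rw [not_and_or, not_le, not_le] at hxy
      rcases hxy with h | h
      · linarith [outside_of_lt h, outside_nonneg R y]
      · linarith [outside_of_lt h, outside_nonneg R x]
    · have h := neg_le_of_abs_le
        (abs_real_inner_le_norm (x - y) (cutoffField R x - cutoffField R y))
      nlinarith [norm_cutoffField_sub_le hR x y, norm_nonneg (x - y)]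

variable (hn : 2 ≤ n) (hG0 : ∀ x, 0 ≤ G x) (hG : Integrable G)
  (hGb : ∀ r : ℝ, ∃ B, ∀ x, ‖x‖ ≤ r → G x ≤ B)
include hn hG0 hG hGb

lemma integrable_logVariation_mul {R ε : ℝ} (hR : 0 < R) (hε0 : 0 ≤ ε) (hε1 : ε ≤ 1) :
    Integrable (fun q => logVariation R ε q * (G q.1 * G q.2)) := by
  obtain ⟨C, hC⟩ := exists_newton_bound hn hG0 hG hGb (2 * R)
  have hC0 : 0 ≤ C := (integral_nonneg fun y => div_nonneg (hG0 y) (norm_nonneg _)).trans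
    (hC 0 (by rw [norm_zero]; positivity)).2
  refine integrable_mul_prod_of_bound hG0 hG (measurable_logVariation hR ε)
    (C := 2 * R * (C + C)) fun x => ?_
  rcases le_total (2 * R) ‖x‖ with hx | hx
  · have h0 : ∀ y, logVariation R ε (x, y) = 0 := fun y => by
      simp [logVariation, shrink_of_le_norm hx]
    simp only [h0, zero_mul, abs_zero, integral_zero]
    exact ⟨integrable_zero _ _ _, by positivity⟩
  · have h1 := hC x hx
    have h2 := hC (shrink R ε x) ((norm_shrink_le hε0 hε1).trans hx)
    have hbound : ∀ᵐ y, |logVariation R ε (x, y)| * G y ≤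
        2 * R * (G y / ‖x - y‖ + G y / ‖shrink R ε x - y‖) := by
      filter_upwards [ae_ne_of_two_le hn x, ae_ne_of_two_le hn (shrink R ε x)] with y hy hy'
      have h := abs_log_sub_log_le (norm_pos_iff.2 (sub_ne_zero.2 hy))
        (norm_pos_iff.2 (sub_ne_zero.2 hy'))
      have hdiff : |‖x - y‖ - ‖shrink R ε x - y‖| ≤ 2 * R := by
        refine (abs_norm_sub_norm_le _ _).trans ?_
        rw [sub_sub_sub_cancel_right, shrink, sub_sub_cancel, norm_smul,
          Real.norm_of_nonneg hε0]
        have := norm_cutoffField_le R x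
        nlinarith [norm_nonneg (cutoffField R x)]
      calc |logVariation R ε (x, y)| * G y
          ≤ 2 * R * (1 / ‖x - y‖ + 1 / ‖shrink R ε x - y‖) * G y := by
            refine mul_le_mul_of_nonneg_right (h.trans ?_) (hG0 y)
            gcongr
        _ = _ := by ring
    have hi : Integrable fun y => 2 * R * (G y / ‖x - y‖ + G y / ‖shrink R ε x - y‖) :=
      (h1.1.add h2.1).const_mul _
    have hk : Integrable fun y => logVariation R ε (x, y) * G y := by
      refine hi.mono' ?_ ?_
      · exact ((measurable_logVariation hR ε).comp measurable_prodMk_left).aestronglyMeasurable.mul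
          hG.aestronglyMeasurable
      · filter_upwards [hbound] with y hy
        rwa [norm_mul, Real.norm_of_nonneg (hG0 y), Real.norm_eq_abs]
    refine ⟨hk, ?_⟩
    have habs : Integrable fun y => |logVariation R ε (x, y)| * G y := by
      refine hk.norm.congr (Eventually.of_forall fun y => ?_)
      simp only [norm_mul, Real.norm_of_nonneg (hG0 y), Real.norm_eq_abs]
    refine (integral_mono_ae habs hi hbound).trans ?_
    rw [integral_const_mul, integral_add h1.1 h2.1]
    have := h1.2
    have := h2.2
    gcongr

lemma integrable_cutoffField_rpow_mul {R : ℝ} (hR : 0 < R) :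
    Integrable (fun q : EuclideanSpace ℝ (Fin n) × EuclideanSpace ℝ (Fin n) =>
      (‖cutoffField R q.1‖ / ‖q.1 - q.2‖) ^ (3 / 2 : ℝ) * (G q.1 * G q.2)) := by
  have hn' : (2 : ℝ) ≤ n := by exact_mod_cast hn
  obtain ⟨C, hC⟩ := exists_riesz_bound (s := 3 / 2) (by omega) (by norm_num) (by linarith)
    hG0 hG hGb (2 * R)
  have hC0 : 0 ≤ C := (integral_nonneg fun y => div_nonneg (hG0 y) (by positivity)).trans
    (hC 0 (by rw [norm_zero]; positivity)).2
  have hX := (continuous_cutoffField (n := n) hR).measurable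
  refine integrable_mul_prod_of_bound hG0 hG
    (k := fun q => (‖cutoffField R q.1‖ / ‖q.1 - q.2‖) ^ (3 / 2 : ℝ)) (by fun_prop)
    (C := (2 * R) ^ (3 / 2 : ℝ) * C) fun x => ?_
  have he : ∀ y, |(‖cutoffField R x‖ / ‖x - y‖) ^ (3 / 2 : ℝ)| =
      (‖cutoffField R x‖ / ‖x - y‖) ^ (3 / 2 : ℝ) := fun y => abs_of_nonneg (by positivity)
  simp only [he]
  rcases le_total (2 * R) ‖x‖ with hx | hx
  · have h32 : (3 / 2 : ℝ) ≠ 0 := by norm_num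
    simp only [cutoffField_eq_zero hx, norm_zero, zero_div, Real.zero_rpow h32, zero_mul,
      integral_zero]
    exact ⟨integrable_zero _ _ _, by positivity⟩
  · have he' : ∀ y, (‖cutoffField R x‖ / ‖x - y‖) ^ (3 / 2 : ℝ) * G y =
        ‖cutoffField R x‖ ^ (3 / 2 : ℝ) * (G y / ‖x - y‖ ^ (3 / 2 : ℝ)) := by
      intro y
      rw [Real.div_rpow (norm_nonneg _) (norm_nonneg _)]
      ring
    simp only [he']
    refine ⟨(hC x hx).1.const_mul _, ?_⟩
    rw [integral_const_mul]
    have h1 := (hC x hx).2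
    have h2 := (norm_cutoffField_le R x).trans hx
    have h3 : 0 ≤ ∫ y, G y / ‖x - y‖ ^ (3 / 2 : ℝ) :=
      integral_nonneg fun y => div_nonneg (hG0 y) (by positivity)
    gcongr

/-- Symmetrization gives a lower bound for the variation of the logarithmic energy. -/
lemma exists_integral_logVariation_ge {R : ℝ} (hR : 0 < R) : ∃ H : ℝ, ∀ ε : ℝ, 0 ≤ ε → ε ≤ 1 / 4 →
    ε / 2 * ((∫ x, G x) ^ 2 - 4 * (∫ x, outside R x * G x) * (∫ x, G x))
      - 4 / 3 * ε ^ (3 / 2 : ℝ) * H ≤ ∫ q, logVariation R ε q * (G q.1 * G q.2) := by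
  let h : EuclideanSpace ℝ (Fin n) × EuclideanSpace ℝ (Fin n) → ℝ := fun q =>
    (‖cutoffField R q.1‖ / ‖q.1 - q.2‖) ^ (3 / 2 : ℝ) * (G q.1 * G q.2)
  have hh : Integrable h := integrable_cutoffField_rpow_mul hn hG0 hG hGb hR
  refine ⟨∫ q, h q, fun ε hε0 hε1 => ?_⟩
  set W : EuclideanSpace ℝ (Fin n) × EuclideanSpace ℝ (Fin n) → ℝ :=
    fun q => logVariation R ε q * (G q.1 * G q.2) with hW_def
  have hW : Integrable W := integrable_logVariation_mul hn hG0 hG hGb hR hε0 (by linarith)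
  have hGG : Integrable (fun q : EuclideanSpace ℝ (Fin n) × EuclideanSpace ℝ (Fin n) =>
      G q.1 * G q.2) := hG.mul_prod hG
  have hoG : Integrable fun x => outside R x * G x :=
    hG.bdd_mul (c := 1) (measurable_outside R).aestronglyMeasurable
      (Eventually.of_forall fun x => by
        rw [Real.norm_of_nonneg (outside_nonneg R x)]; exact outside_le_one R x)
  let o : EuclideanSpace ℝ (Fin n) × EuclideanSpace ℝ (Fin n) → ℝ :=
    fun q => outside R q.1 * G q.1 * G q.2
  have ho : Integrable o := hoG.mul_prod hG
  have hswap : ∀ f : EuclideanSpace ℝ (Fin n) × EuclideanSpace ℝ (Fin n) → ℝ,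
      ∫ q : EuclideanSpace ℝ (Fin n) × EuclideanSpace ℝ (Fin n), f q.swap = ∫ q, f q :=
    fun f => integral_prod_swap (μ := volume) (ν := volume) f
  have hlow : ∀ᵐ q, ε * (G q.1 * G q.2 - 2 * (o q + o q.swap))
      - 4 / 3 * ε ^ (3 / 2 : ℝ) * (h q + h q.swap) ≤ W q + W q.swap := by
    have hsw := (Measure.measurePreserving_swap (μ := (volume : Measure (EuclideanSpace ℝ (Fin n))))
      (ν := (volume : Measure (EuclideanSpace ℝ (Fin n))))).quasiMeasurePreserving.ae
      (ae_ne_comp_fst hn (continuous_shrink hR ε))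
    filter_upwards [ae_ne_comp_fst hn continuous_id, ae_ne_comp_fst hn (continuous_shrink hR ε),
      hsw] with q h1 h2 h3
    obtain ⟨κ, hκ, hκ1, hκi⟩ := cutoffField_sub_inner_ge hR q.1 q.2
    have hmain := symm_log_sub_ge h1 hκi hκ1 hε0 (by linarith) h2 h3
    rw [Real.mul_rpow hε0 (by positivity), Real.mul_rpow hε0 (by positivity)] at hmain
    have hmul := mul_le_mul_of_nonneg_right hmain (mul_nonneg (hG0 q.1) (hG0 q.2))
    have hκ' := mul_le_mul_of_nonneg_right (mul_le_mul_of_nonneg_left hκ hε0)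
      (mul_nonneg (hG0 q.1) (hG0 q.2))
    simp only [hW_def, h, o, logVariation, id_eq, Prod.fst_swap, Prod.snd_swap, shrink,
      norm_sub_rev q.2 q.1] at hmul hκ' ⊢
    linarith
  have hint := integral_mono_ae
    (((hGG.sub ((ho.add ho.swap).const_mul 2)).const_mul ε).sub
      ((hh.add hh.swap).const_mul (4 / 3 * ε ^ (3 / 2 : ℝ)))) (hW.add hW.swap) hlow
  have hos : Integrable (o ∘ Prod.swap) := ho.swap
  have hhs : Integrable (h ∘ Prod.swap) := hh.swap
  have hWs : Integrable (W ∘ Prod.swap) := hW.swap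
  have hGGi : ∫ q : EuclideanSpace ℝ (Fin n) × EuclideanSpace ℝ (Fin n), G q.1 * G q.2 =
      (∫ x, G x) ^ 2 := by
    rw [sq]
    exact integral_prod_mul G G
  have hoi : ∫ q, o q = (∫ x, outside R x * G x) * (∫ x, G x) :=
    integral_prod_mul (fun x => outside R x * G x) G
  rw [integral_sub' ((hGG.sub ((ho.add hos).const_mul 2)).const_mul ε)
    ((hh.add hhs).const_mul _), integral_const_mul, integral_const_mul,
    integral_sub' hGG ((ho.add hos).const_mul 2), integral_const_mul, integral_add' ho hos,
    integral_add' hh hhs, integral_add' hW hWs] at hint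
  simp only [Function.comp_def, hswap, hGGi, hoi] at hint
  linarith

end Dilation

lemma betaN_pos {n : ℕ} (hn : 2 ≤ n) : 0 < betaN n := by
  have hn' : (0 : ℝ) < n := by positivity
  have h1 := Real.Gamma_pos_of_pos (s := (n : ℝ) / 2 + 1) (by positivity)
  have h2 := Real.Gamma_pos_of_pos (s := (n : ℝ) / 2) (by positivity)
  have h3 : 0 < (volume (ball (0 : EuclideanSpace ℝ (Fin n)) 1)).toReal :=
    ENNReal.toReal_pos (measure_ball_pos _ _ one_pos).ne' measure_ball_lt_top.ne
  unfold betaN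
  positivity

lemma tendsto_integral_outside {n : ℕ} {G : EuclideanSpace ℝ (Fin n) → ℝ} (hG : Integrable G) :
    Tendsto (fun R => ∫ x, outside R x * G x) atTop (nhds 0) := by
  have h0 : ∫ _ : EuclideanSpace ℝ (Fin n), (0 : ℝ) = 0 := integral_zero _ _
  rw [← h0]
  refine tendsto_integral_filter_of_dominated_convergence (fun x => ‖G x‖)
    (Eventually.of_forall fun R =>
      (measurable_outside R).aestronglyMeasurable.mul hG.aestronglyMeasurable)
    (Eventually.of_forall fun R => Eventually.of_forall fun x => ?_) hG.norm
    (Eventually.of_forall fun x => tendsto_const_nhds.congr' ?_)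
  · rw [norm_mul, Real.norm_of_nonneg (outside_nonneg R x)]
    exact mul_le_of_le_one_left (norm_nonneg _) (outside_le_one R x)
  · filter_upwards [eventually_ge_atTop ‖x‖] with R hR
    rw [outside_of_le hR, zero_mul]

section Solution

variable {n : ℕ} {μ : ℝ} {u : EuclideanSpace ℝ (Fin n) → ℝ}

lemma exists_weight_le (hu : Continuous u) (r : ℝ) :
    ∃ B, ∀ x, ‖x‖ ≤ r → weight n μ u x ≤ B := by
  obtain ⟨B, hB⟩ := (isCompact_closedBall (0 : EuclideanSpace ℝ (Fin n)) r).bddAbove_image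
    (continuous_weight (μ := μ) hu).continuousOn
  exact ⟨B, fun x hx => hB ⟨x, by simpa using hx, rfl⟩⟩

variable (hn : 2 ≤ n) (hμ0 : 0 < μ) (hμn : μ < n) (hu : Continuous u) (hB : CondB n μ u)
include hn hμ0 hμn hu hB

lemma exists_V_le (r : ℝ) : ∃ B, ∀ x, ‖x‖ ≤ r →
    Integrable (fun y => weight n μ u y / ‖x - y‖ ^ μ) ∧ V n μ u x ≤ B :=
  exists_riesz_bound (by omega) hμ0.le hμn (fun x => (weight_pos x).le) hB.1 (exists_weight_le hu) r

lemma exists_density_le (r : ℝ) : ∃ B, ∀ x, ‖x‖ ≤ r → density n μ u x ≤ B := by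
  obtain ⟨B, hV⟩ := exists_V_le hn hμ0 hμn hu hB r
  obtain ⟨B', hW⟩ := exists_weight_le (μ := μ) hu r
  refine ⟨B * B', fun x hx => ?_⟩
  exact mul_le_mul (hV x hx).2 (hW x hx) (weight_pos x).le
    ((V_nonneg x).trans (hV x hx).2)

variable (hIE : IE n μ u)
include hIE

lemma betaN_mul_sub (x z : EuclideanSpace ℝ (Fin n)) :
    betaN n * (u z - u x) = ∫ y, (Real.log ‖x - y‖ - Real.log ‖z - y‖) * density n μ u y := by
  obtain ⟨C, hC⟩ := hIE
  rw [← integral_log_ratio_sub hn density_nonneg (integrable_density hB.2)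
    (exists_density_le hn hμ0 hμn hu hB), hC x, hC z]
  have := (betaN_pos hn).ne'
  simp only [density, weight]
  field_simp
  ring

lemma betaN_mul_integral_shrink {R ε : ℝ} (hR : 0 < R) (hε0 : 0 ≤ ε) (hε1 : ε ≤ 1) :
    betaN n * ∫ x, (u (shrink R ε x) - u x) * density n μ u x =
      ∫ q, logVariation R ε q * (density n μ u q.1 * density n μ u q.2) := by
  rw [Measure.volume_eq_prod, integral_prod _ (integrable_logVariation_mul hn density_nonneg
    (integrable_density hB.2) (exists_density_le hn hμ0 hμn hu hB) hR hε0 hε1),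
    ← integral_const_mul]
  refine integral_congr_ae (Eventually.of_forall fun x => ?_)
  simp only
  rw [← mul_assoc, betaN_mul_sub hn hμ0 hμn hu hB hIE, ← integral_mul_const]
  simp only [logVariation]
  congr 1
  ext y
  ring

lemma integral_density_sq_le_add {R : ℝ} (hR : 0 < R) :
    (2 * n - μ) / 2 * (1 / 2 * ((∫ x, density n μ u x) ^ 2
      - 4 * (∫ x, outside R x * density n μ u x) * (∫ x, density n μ u x))) ≤
    betaN n * (3 * μ * (∫ x, outside R x * density n μ u x)
      + (2 * n - μ) / 2 * ∫ x, density n μ u x) := by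
  obtain ⟨H, hH⟩ := exists_integral_logVariation_ge hn (density_nonneg (μ := μ) (u := u))
    (integrable_density hB.2) (exists_density_le hn hμ0 hμn hu hB) hR
  set M := ∫ x, density n μ u x with hM
  set σ := ∫ x, outside R x * density n μ u x
  set p := (2 * n - μ) / 2 with hp
  have hp0 : 0 < p := by rw [hp]; linarith
  have hM0 : 0 ≤ M := integral_nonneg density_nonneg
  have hβ := betaN_pos hn
  have key : ∀ᶠ ε in nhdsWithin (0 : ℝ) (Set.Ioi 0),
      p * (1 / 2 * (M ^ 2 - 4 * σ * M) - 4 / 3 * ε ^ (1 / 2 : ℝ) * H) ≤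
        betaN n * (3 * μ * σ + p * (M * (1 - ε)⁻¹)) := by
    filter_upwards [Ioc_mem_nhdsGT (show (0 : ℝ) < 1 / 4 by norm_num)] with ε hε
    have h1 := hH ε hε.1.le hε.2
    rw [← betaN_mul_integral_shrink hn hμ0 hμn hu hB hIE hR hε.1.le (by linarith [hε.2])] at h1
    have h2 := (integral_shrink_variation_le hμ0 hu hB.2 hR hε.1.le hε.2).2
    have h3 : -Real.log (1 - ε) ≤ ε * (1 - ε)⁻¹ := by
      have h1ε : 0 < 1 - ε := by linarith [hε.2]
      have := Real.one_sub_inv_le_log_of_pos h1ε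
      have he : ε * (1 - ε)⁻¹ = (1 - ε)⁻¹ - 1 := by field_simp; ring
      linarith
    have h4 : p * (betaN n * ∫ x, (u (shrink R ε x) - u x) * density n μ u x) ≤
        betaN n * (3 * μ * ε * σ + p * (ε * (1 - ε)⁻¹) * M) := by
      calc _ = betaN n * (p * ∫ x, (u (shrink R ε x) - u x) * density n μ u x) := by ring
        _ ≤ betaN n * (3 * μ * ε * σ - p * Real.log (1 - ε) * M) := by gcongr
        _ = betaN n * (3 * μ * ε * σ + p * (-Real.log (1 - ε)) * M) := by ring
        _ ≤ _ := by gcongr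
    have h5 := (mul_le_mul_of_nonneg_left h1 hp0.le).trans h4
    have h6 : ε ^ (3 / 2 : ℝ) = ε * ε ^ (1 / 2 : ℝ) := by
      rw [show (3 / 2 : ℝ) = 1 + 1 / 2 by norm_num, Real.rpow_add hε.1, Real.rpow_one]
    rw [h6] at h5
    refine le_of_mul_le_mul_left ?_ hε.1
    linarith
  have hc : Tendsto (fun ε : ℝ => ε ^ (1 / 2 : ℝ)) (nhdsWithin 0 (Set.Ioi 0)) (nhds 0) := by
    have h := (Real.continuousAt_rpow_const 0 (1 / 2 : ℝ) (Or.inr (by norm_num))).tendsto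
    rw [Real.zero_rpow (by norm_num)] at h
    exact h.mono_left nhdsWithin_le_nhds
  have hi : Tendsto (fun ε : ℝ => (1 - ε)⁻¹) (nhdsWithin 0 (Set.Ioi 0)) (nhds 1) := by
    have h : ContinuousAt (fun ε : ℝ => (1 - ε)⁻¹) 0 := by
      refine ContinuousAt.inv₀ (by fun_prop) (by norm_num)
    have h' := h.tendsto
    rw [sub_zero, inv_one] at h'
    exact h'.mono_left nhdsWithin_le_nhds
  have hl := ((hc.const_mul (4 / 3)).mul_const H).const_sub (1 / 2 * (M ^ 2 - 4 * σ * M))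
    |>.const_mul p
  have hr := ((hi.const_mul M).const_mul p).const_add (3 * μ * σ) |>.const_mul (betaN n)
  have := le_of_tendsto_of_tendsto hl hr key
  simpa using this

lemma integral_density_le : ∫ x, density n μ u x ≤ 2 * betaN n := by
  have hσ := tendsto_integral_outside (integrable_density hB.2)
  set M := ∫ x, density n μ u x with hM
  have hp0 : 0 < (2 * n - μ) / 2 := by linarith
  have hl := (((hσ.const_mul 4).mul_const M).const_sub (M ^ 2)).const_mul (1 / 2 : ℝ)
    |>.const_mul ((2 * n - μ) / 2)
  have hr := ((hσ.const_mul (3 * μ)).add_const ((2 * n - μ) / 2 * M)).const_mul (betaN n)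
  have h := le_of_tendsto_of_tendsto hl hr ((eventually_gt_atTop 0).mono fun R hR =>
    integral_density_sq_le_add hn hμ0 hμn hu hB hIE hR)
  have h' : (2 * n - μ) / 2 * (M * M) ≤ (2 * n - μ) / 2 * (2 * betaN n * M) := by
    linarith
  have h'' := le_of_mul_le_mul_left h' hp0
  rcases (integral_nonneg density_nonneg : 0 ≤ M).eq_or_lt with h0 | h0
  · linarith [betaN_pos hn, (h0.symm : M = 0)]
  · exact le_of_mul_le_mul_right h'' h0

/-- A solution decays at most like `-2 log(1 + ‖x‖)`. -/
lemma exists_le_solution : ∃ C, ∀ x, C - 2 * Real.log (1 + ‖x‖) ≤ u x := by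
  have hM := integral_density_le hn hμ0 hμn hu hB hIE
  obtain ⟨C, hC⟩ := hIE
  refine ⟨C, fun x => ?_⟩
  have h := integral_log_ratio_ge hn density_nonneg (integrable_density hB.2)
    (exists_density_le hn hμ0 hμn hu hB) x
  have hβ := betaN_pos hn
  have hl : 0 ≤ Real.log (1 + ‖x‖) := Real.log_nonneg (by linarith [norm_nonneg x])
  have h2 : -(2 * Real.log (1 + ‖x‖)) ≤ 1 / betaN n *
      ∫ y, Real.log ((‖y‖ + 1) / ‖x - y‖) * density n μ u y := by
    rw [one_div_mul_eq_div, le_div_iff₀ hβ]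
    nlinarith
  rw [hC x]
  simp only [density, weight] at h2
  linarith

end Solution

lemma exists_le_add_log {n : ℕ} {f : EuclideanSpace ℝ (Fin n) → ℝ} (hf : ContDiffAt ℝ 1 f 0)
    {a : ℝ} (ha : 0 < a) : ∃ r > 0, ∀ t : ℝ, 1 ≤ t → ∀ z, ‖t ^ 2 • z‖ < r →
      f z ≤ f (t ^ 2 • z) + a * Real.log t := by
  obtain ⟨K, s, hs, hK⟩ := hf.exists_lipschitzOnWith
  obtain ⟨r, hr, hrs⟩ := Metric.mem_nhds_iff.1 hs
  refine ⟨min r (a / 2 / (K + 1)), by positivity, fun t ht z hz => ?_⟩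
  have ht0 : 0 < t := by linarith
  have ht2 : 1 ≤ t ^ 2 := one_le_pow₀ ht
  have hle : ‖z‖ ≤ ‖t ^ 2 • z‖ := by
    rw [norm_smul, Real.norm_of_nonneg (by positivity)]
    exact le_mul_of_one_le_left (norm_nonneg _) ht2
  have hz1 : z ∈ s := hrs (by simpa using hle.trans_lt (hz.trans_le (min_le_left _ _)))
  have hz2 : t ^ 2 • z ∈ s := hrs (by simpa using hz.trans_le (min_le_left _ _))
  have hd := hK.dist_le_mul z hz1 _ hz2
  rw [Real.dist_eq, dist_eq_norm, norm_sub_rev z,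
    show t ^ 2 • z - z = (t ^ 2 - 1) • z by rw [sub_smul, one_smul], norm_smul,
    Real.norm_of_nonneg (by linarith)] at hd
  have hz3 := hz.trans_le (min_le_right _ _)
  rw [norm_smul, Real.norm_of_nonneg (by positivity), lt_div_iff₀ (by positivity)] at hz3
  have hlog := Real.one_sub_inv_le_log_of_pos (x := t ^ 2) (by positivity)
  rw [Real.log_pow] at hlog
  push_cast at hlog
  have hinv : 0 ≤ 1 - (t ^ 2)⁻¹ := sub_nonneg.2 (inv_le_one_of_one_le₀ ht2)
  have h1 : K * ((t ^ 2 - 1) * ‖z‖) ≤ (1 - (t ^ 2)⁻¹) * (a / 2) := by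
    calc K * ((t ^ 2 - 1) * ‖z‖) = (1 - (t ^ 2)⁻¹) * (t ^ 2 * ‖z‖ * K) := by field_simp
      _ ≤ (1 - (t ^ 2)⁻¹) * (t ^ 2 * ‖z‖ * (K + 1)) := by gcongr; linarith
      _ ≤ _ := by gcongr
  nlinarith [(abs_le.1 hd).2]

lemma norm_sq_smul_sub_le {n : ℕ} {t : ℝ} (ht : 1 ≤ t) {z ξ : EuclideanSpace ℝ (Fin n)}
    (hz : ‖t ^ 2 • z‖ ≤ ‖ξ‖) : ‖t ^ 2 • z - ξ‖ ≤ t * ‖z - ξ‖ := by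
  have ht2 : 1 ≤ t ^ 2 := one_le_pow₀ ht
  refine (sq_le_sq₀ (norm_nonneg _) (by positivity)).1 ?_
  rw [norm_smul, Real.norm_of_nonneg (by positivity)] at hz
  rw [mul_pow, norm_sub_sq_real, norm_sub_sq_real, norm_smul, real_inner_smul_left,
    Real.norm_of_nonneg (by positivity)]
  have h1 : (t ^ 2 * ‖z‖) ^ 2 ≤ ‖ξ‖ ^ 2 := by gcongr
  have h2 : t ^ 2 * ‖z‖ ^ 2 ≤ ‖ξ‖ ^ 2 := by
    nlinarith [sq_nonneg ‖z‖, mul_nonneg (sq_nonneg t) (sq_nonneg ‖z‖)]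
  nlinarith

lemma locallyIntegrable_norm_rpow_inv {n : ℕ} (hn : 1 ≤ n) {s : ℝ} (hs : s < n) :
    LocallyIntegrable (fun z : EuclideanSpace ℝ (Fin n) => (‖z‖ ^ s)⁻¹) := fun x =>
  ⟨ball 0 (‖x‖ + 1), isOpen_ball.mem_nhds (by simp), integrableOn_ball_norm_rpow_inv hn hs⟩

/-- The Riesz potential of a `C¹` function with compact support is `C¹`. -/
lemma contDiff_riesz {n : ℕ} (hn : 1 ≤ n) {s : ℝ} (hs : s < n)
    {f : EuclideanSpace ℝ (Fin n) → ℝ} (hf : ContDiff ℝ 1 f) (hfc : HasCompactSupport f) :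
    ContDiff ℝ 1 fun x => ∫ y, f y / ‖x - y‖ ^ s := by
  have h := hfc.contDiff_convolution_left (ContinuousLinearMap.mul ℝ ℝ) hf
    (locallyIntegrable_norm_rpow_inv hn hs)
  exact h

/-- Far from its density, the Riesz potential is monotone along the moving spheres. -/
lemma integral_riesz_le_of_far {n : ℕ} {s t : ℝ} (hs : 0 ≤ s) (ht : 1 ≤ t)
    {g : EuclideanSpace ℝ (Fin n) → ℝ} (hg0 : ∀ x, 0 ≤ g x) (hg : ∀ x, ‖x‖ < 1 → g x = 0)
    {z : EuclideanSpace ℝ (Fin n)} (hz : ‖t ^ 2 • z‖ < 1)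
    (h1 : Integrable fun y => g y / ‖z - y‖ ^ s)
    (h2 : Integrable fun y => g y / ‖t ^ 2 • z - y‖ ^ s) :
    ∫ y, g y / ‖z - y‖ ^ s ≤ t ^ s * ∫ y, g y / ‖t ^ 2 • z - y‖ ^ s := by
  rw [← integral_const_mul]
  refine integral_mono h1 (h2.const_mul _) fun y => ?_
  simp only
  rcases lt_or_ge ‖y‖ 1 with hy | hy
  · simp [hg y hy]
  have hd : 0 < ‖t ^ 2 • z - y‖ := norm_pos_iff.2 (sub_ne_zero.2 fun h => by
    rw [h] at hz
    linarith)
  have hle := norm_sq_smul_sub_le ht (hz.le.trans hy)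
  have hd' : 0 < ‖z - y‖ := by
    by_contra! h
    nlinarith
  have hpow : ‖t ^ 2 • z - y‖ ^ s ≤ t ^ s * ‖z - y‖ ^ s := by
    rw [← Real.mul_rpow (by linarith) hd'.le]
    gcongr
  rw [mul_div_assoc', div_le_div_iff₀ (by positivity) (by positivity)]
  nlinarith [mul_le_mul_of_nonneg_left hpow (hg0 y)]

lemma integral_pos_of_ae_pos_on_ball {n : ℕ} {f : EuclideanSpace ℝ (Fin n) → ℝ}
    (hf : Integrable f) (hf0 : ∀ x, 0 ≤ f x) (hpos : ∀ᵐ x, x ∈ ball 0 1 → 0 < f x) :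
    0 < ∫ x, f x := by
  rw [integral_pos_iff_support_of_nonneg hf0 hf]
  refine (measure_ball_pos volume (0 : EuclideanSpace ℝ (Fin n)) one_pos).trans_le
    (measure_mono_ae ?_)
  filter_upwards [hpos] with x hx hxb
  exact (hx hxb).ne'

section Solution

variable {n : ℕ} {μ : ℝ} {u : EuclideanSpace ℝ (Fin n) → ℝ}
variable (hn : 2 ≤ n) (hμ0 : 0 < μ) (hμn : μ < n) (hu : ContDiff ℝ n u) (hB : CondB n μ u)
include hn hμ0 hμn hu hB

lemma exists_V_le_of_near : ∃ r > 0, ∀ t : ℝ, 1 ≤ t → ∀ z, ‖t ^ 2 • z‖ < r →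
    V n μ u z ≤ t ^ μ * V n μ u (t ^ 2 • z) := by
  have hw1 : ContDiff ℝ 1 (weight n μ u) := by
    have h1 : ContDiff ℝ 1 u := hu.of_le (by exact_mod_cast (by omega : 1 ≤ n))
    unfold weight
    fun_prop
  obtain ⟨B, hV⟩ := exists_V_le hn hμ0 hμn hu.continuous hB 1
  let η : ContDiffBump (0 : EuclideanSpace ℝ (Fin n)) := ⟨1, 2, one_pos, one_lt_two⟩
  let f : EuclideanSpace ℝ (Fin n) → ℝ := fun y => η y * weight n μ u y
  let g : EuclideanSpace ℝ (Fin n) → ℝ := fun y => (1 - η y) * weight n μ u y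
  have hf0 : ∀ y, 0 ≤ f y := fun y => mul_nonneg η.nonneg (weight_pos y).le
  have hg0 : ∀ y, 0 ≤ g y := fun y =>
    mul_nonneg (sub_nonneg.2 η.le_one) (weight_pos y).le
  have hg1 : ∀ y, ‖y‖ < 1 → g y = 0 := fun y hy => by
    simp only [g]
    rw [η.one_of_mem_closedBall (by simpa using hy.le), sub_self, zero_mul]
  have hf : ContDiff ℝ 1 f := η.contDiff.mul hw1
  have hfi : ∀ x, ‖x‖ ≤ 1 → Integrable fun y => f y / ‖x - y‖ ^ μ := fun x hx => by
    refine ((hV x hx).1.bdd_mul (c := 1) η.continuous.aestronglyMeasurable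
      (Eventually.of_forall fun y => ?_)).congr (Eventually.of_forall fun y => ?_)
    · rw [Real.norm_of_nonneg η.nonneg]
      exact η.le_one
    · simp only [f]
      ring
  have hgi : ∀ x, ‖x‖ ≤ 1 → Integrable fun y => g y / ‖x - y‖ ^ μ := fun x hx => by
    refine ((hV x hx).1.sub (hfi x hx)).congr (Eventually.of_forall fun y => ?_)
    simp only [f, g, Pi.sub_apply]
    ring
  have hsplit : ∀ x, ‖x‖ ≤ 1 → V n μ u x =
      (∫ y, f y / ‖x - y‖ ^ μ) + ∫ y, g y / ‖x - y‖ ^ μ := fun x hx => by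
    rw [← integral_add (hfi x hx) (hgi x hx)]
    unfold V
    congr 1
    ext y
    simp only [f, g, weight]
    ring
  have hpos : ∀ x, ‖x‖ ≤ 1 → 0 < ∫ y, f y / ‖x - y‖ ^ μ := fun x hx => by
    refine integral_pos_of_ae_pos_on_ball (hfi x hx)
      (fun y => div_nonneg (hf0 y) (by positivity)) ?_
    filter_upwards [ae_ne_of_two_le hn x] with y hy hyb
    have h1 : 0 < ‖x - y‖ := norm_pos_iff.2 (sub_ne_zero.2 hy)
    have h2 := weight_pos (n := n) (μ := μ) (u := u) y
    have h3 : 0 < η y := η.pos_of_mem_ball (ball_subset_ball one_le_two hyb)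
    simp only [f]
    positivity
  have hlog : ContDiffAt ℝ 1 (fun x => Real.log (∫ y, f y / ‖x - y‖ ^ μ)) 0 :=
    (contDiff_riesz (by omega) hμn hf (η.hasCompactSupport.mul_right)).contDiffAt.log
      (hpos 0 (by simp)).ne'
  obtain ⟨r, hr, h⟩ := exists_le_add_log hlog hμ0
  refine ⟨min r 1, by positivity, fun t ht z hz => ?_⟩
  have ht0 : 0 < t := by linarith
  have hz2 : ‖t ^ 2 • z‖ < 1 := hz.trans_le (min_le_right _ _)
  have hz1 : ‖z‖ ≤ 1 := by
    refine le_trans ?_ hz2.le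
    rw [norm_smul, Real.norm_of_nonneg (by positivity)]
    exact le_mul_of_one_le_left (norm_nonneg _) (one_le_pow₀ ht)
  have h1 := h t ht z (hz.trans_le (min_le_left _ _))
  rw [add_comm, ← Real.log_rpow ht0, ← Real.log_mul (by positivity) (hpos _ hz2.le).ne',
    Real.log_le_log_iff (hpos _ hz1) (mul_pos (by positivity) (hpos _ hz2.le))] at h1
  have h2 := integral_riesz_le_of_far hμ0.le ht hg0 hg1 hz2 (hgi z hz1) (hgi _ hz2.le)
  rw [hsplit z hz1, hsplit _ hz2.le, mul_add]
  exact add_le_add h1 h2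

lemma exists_V_ge : ∃ c > 0, ∀ x, c / (1 + ‖x‖) ^ μ ≤ V n μ u x := by
  have hnum : Integrable fun y => weight n μ u y / (1 + ‖y‖) ^ μ := by
    have hw : Integrable (weight n μ u) := hB.1
    refine hw.mono' ?_ (Eventually.of_forall fun y => ?_)
    · have := (continuous_weight (μ := μ) hu.continuous).measurable
      exact (by fun_prop : Measurable fun y => weight n μ u y / (1 + ‖y‖) ^ μ).aestronglyMeasurable
    · rw [Real.norm_of_nonneg (div_nonneg (weight_pos y).le (by positivity))]
      exact div_le_self (weight_pos y).le
        (Real.one_le_rpow (by linarith [norm_nonneg y]) hμ0.le)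
  have hpos : ∀ y, 0 < weight n μ u y / (1 + ‖y‖) ^ μ := fun y =>
    div_pos (weight_pos y) (by positivity)
  refine ⟨_, integral_pos_of_ae_pos_on_ball hnum (fun y => (hpos y).le)
    (Eventually.of_forall fun y _ => hpos y), fun x => ?_⟩
  obtain ⟨B, hV⟩ := exists_V_le hn hμ0 hμn hu.continuous hB ‖x‖
  rw [← integral_div]
  refine integral_mono_ae (hnum.div_const _) (hV x le_rfl).1 ?_
  filter_upwards [ae_ne_of_two_le hn x] with y hy
  have hd : 0 < ‖x - y‖ := norm_pos_iff.2 (sub_ne_zero.2 hy)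
  rw [div_div, ← Real.mul_rpow (by positivity) (by positivity)]
  refine div_le_div_of_nonneg_left (weight_pos y).le (by positivity) ?_
  gcongr
  linarith [norm_sub_le_one_add_mul x y]

end Solution

lemma wMS_zero_nonneg_iff {n : ℕ} {u : EuclideanSpace ℝ (Fin n) → ℝ} {ρ : ℝ} (hρ : 0 < ρ)
    {x : EuclideanSpace ℝ (Fin n)} (hx : 0 < ‖x‖) :
    0 ≤ wMS n u 0 ρ x ↔ u ((ρ ^ 2)⁻¹ • x) ≤
      u ((ρ / ‖x‖) ^ 2 • (ρ ^ 2)⁻¹ • x) + 2 * Real.log (ρ / ‖x‖) := by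
  have h : (ρ / ‖x‖) ^ 2 • (ρ ^ 2)⁻¹ • x = (‖x‖ ^ 2)⁻¹ • x := by
    rw [smul_smul]
    congr 1
    field_simp
  rw [h, wMS, zero_add, zero_add, Real.log_div hρ.ne' hx.ne']
  constructor <;> intro <;> linarith

lemma zMS_zero_nonneg_iff {n : ℕ} {μ : ℝ} {u : EuclideanSpace ℝ (Fin n) → ℝ} {ρ : ℝ} (hρ : 0 < ρ)
    {x : EuclideanSpace ℝ (Fin n)} (hx : 0 < ‖x‖) :
    0 ≤ zMS n μ u 0 ρ x ↔ V n μ u ((ρ ^ 2)⁻¹ • x) ≤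
      (ρ / ‖x‖) ^ μ * V n μ u ((ρ / ‖x‖) ^ 2 • (ρ ^ 2)⁻¹ • x) := by
  have h : (ρ / ‖x‖) ^ 2 • (ρ ^ 2)⁻¹ • x = (‖x‖ ^ 2)⁻¹ • x := by
    rw [smul_smul]
    congr 1
    field_simp
  have h1 : 0 < ρ ^ μ := by positivity
  have h2 : 0 < ‖x‖ ^ μ := by positivity
  rw [h, zMS, zero_add, zero_add, sub_nonneg, Real.div_rpow hρ.le hx.le, Real.rpow_neg hρ.le,
    Real.rpow_neg hx.le, inv_mul_le_iff₀ h1, div_eq_mul_inv, mul_assoc]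

section Solution

variable {n : ℕ} {μ : ℝ} {u : EuclideanSpace ℝ (Fin n) → ℝ}
variable (hn : 2 ≤ n) (hμ0 : 0 < μ) (hμn : μ < n) (hu : ContDiff ℝ n u) (hB : CondB n μ u)
include hn hμ0 hμn hu hB

/-- The moving spheres about the origin can be started from large radii. -/
lemma exists_start (hIE : IE n μ u) : ∃ l > 0, ∀ ρ : ℝ, l ≤ ρ → ∀ x : EuclideanSpace ℝ (Fin n),
    0 < ‖x‖ → ‖x‖ < ρ → 0 ≤ wMS n u 0 ρ x ∧ 0 ≤ zMS n μ u 0 ρ x := by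
  have hu1 : ContDiff ℝ 1 u := hu.of_le (by exact_mod_cast (by omega : 1 ≤ n))
  obtain ⟨r₁, hr₁, hnear₁⟩ := exists_le_add_log (hu1.contDiffAt (x := 0)) two_pos
  obtain ⟨r₂, hr₂, hnear₂⟩ := exists_V_le_of_near hn hμ0 hμn hu hB
  obtain ⟨C, hC⟩ := exists_le_solution hn hμ0 hμn hu.continuous hB hIE
  obtain ⟨c, hc, hV⟩ := exists_V_ge hn hμ0 hμn hu hB
  obtain ⟨Bv, hBv⟩ := exists_V_le hn hμ0 hμn hu.continuous hB 1
  obtain ⟨Bu, hBu⟩ := (isCompact_closedBall (0 : EuclideanSpace ℝ (Fin n)) 1).bddAbove_image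
    hu.continuous.continuousOn
  set r := min r₁ r₂
  have hr : 0 < r := lt_min hr₁ hr₂
  have e1 : ∀ᶠ ρ : ℝ in atTop, 1 / r ≤ ρ ^ 2 :=
    (tendsto_pow_atTop two_ne_zero).eventually_ge_atTop _
  have e2 : ∀ᶠ ρ : ℝ in atTop, (Bu - C + 2 * Real.log (1 / r + 1)) / 2 ≤ Real.log ρ :=
    Real.tendsto_log_atTop.eventually_ge_atTop _
  have e3 : ∀ᶠ ρ : ℝ in atTop, Bv * (1 / r + 1) ^ μ / c ≤ ρ ^ μ :=
    (tendsto_rpow_atTop hμ0).eventually_ge_atTop _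
  obtain ⟨l, hl⟩ := eventually_atTop.1 (((eventually_gt_atTop 0).and e1).and (e2.and e3))
  refine ⟨l, (hl l le_rfl).1.1, fun ρ hρ x hx hxρ => ?_⟩
  obtain ⟨⟨hρ0, h1⟩, h2, h3⟩ := hl ρ hρ
  rw [wMS_zero_nonneg_iff hρ0 hx, zMS_zero_nonneg_iff hρ0 hx]
  set t := ρ / ‖x‖ with ht_def
  have ht : 1 ≤ t := (one_le_div hx).2 hxρ.le
  have hnorm : ‖t ^ 2 • (ρ ^ 2)⁻¹ • x‖ = 1 / ‖x‖ := by
    rw [norm_smul, norm_smul, Real.norm_of_nonneg (by positivity),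
      Real.norm_of_nonneg (by positivity), ht_def]
    field_simp
  rcases lt_or_ge (1 / ‖x‖) r with hfar | hfar
  · rw [← hnorm] at hfar
    exact ⟨hnear₁ t ht _ (hfar.trans_le (min_le_left _ _)),
      hnear₂ t ht _ (hfar.trans_le (min_le_right _ _))⟩
  · have hxr : ‖x‖ ≤ 1 / r := by
      rw [le_div_iff₀ hx] at hfar
      rw [le_div_iff₀ hr]
      linarith
    have hz : ‖(ρ ^ 2)⁻¹ • x‖ ≤ 1 := by
      rw [norm_smul, Real.norm_of_nonneg (by positivity), inv_mul_le_iff₀ (by positivity), mul_one]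
      exact hxr.trans h1
    have hsum : 1 + 1 / ‖x‖ = (‖x‖ + 1) / ‖x‖ := by field_simp
    constructor
    · have hu1 : u ((ρ ^ 2)⁻¹ • x) ≤ Bu := hBu ⟨_, by simpa using hz, rfl⟩
      have hu2 := hC (t ^ 2 • (ρ ^ 2)⁻¹ • x)
      rw [hnorm, hsum, Real.log_div (by positivity) hx.ne'] at hu2
      rw [ht_def, Real.log_div hρ0.ne' hx.ne', ← ht_def]
      have hlog : Real.log (‖x‖ + 1) ≤ Real.log (1 / r + 1) := by gcongr
      linarith
    · refine ((hBv _ hz).2).trans ?_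
      have hv := hV (t ^ 2 • (ρ ^ 2)⁻¹ • x)
      rw [hnorm, hsum] at hv
      refine le_trans ?_ (mul_le_mul_of_nonneg_left hv (by positivity))
      rw [ht_def, Real.div_rpow hρ0.le hx.le, Real.div_rpow (by positivity) hx.le]
      have hp : 0 < ‖x‖ ^ μ := by positivity
      have hle : (‖x‖ + 1) ^ μ ≤ (1 / r + 1) ^ μ := by gcongr
      have hBv0 : 0 ≤ Bv := (V_nonneg _).trans (hBv 0 (by simp)).2
      rw [div_le_iff₀ hc] at h3
      calc Bv ≤ ρ ^ μ * c / (‖x‖ + 1) ^ μ := by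
            rw [le_div_iff₀ (by positivity)]
            exact (mul_le_mul_of_nonneg_left hle hBv0).trans h3
        _ = _ := by field_simp

end Solution

/-- Monotonicity along all spheres about the origin contradicts integrability. -/
lemma exists_lt_of_integrable_weight {n : ℕ} {μ : ℝ} {u : EuclideanSpace ℝ (Fin n) → ℝ}
    (hn : 2 ≤ n) (hμ0 : 0 < μ) (hμn : μ < n) (hW : Integrable (weight n μ u)) :
    ∃ z ≠ 0, u ((2 : ℝ) ^ 2 • z) + 2 * Real.log 2 < u z := by
  by_contra! h
  set p := (2 * n - μ) / 2 with hp
  have hp0 : 0 < p := by rw [hp]; linarith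
  have hpt : ∀ᵐ z, weight n μ u z ≤ (2 : ℝ) ^ (2 * p) * weight n μ u ((2 : ℝ) ^ 2 • z) := by
    filter_upwards [ae_ne_of_two_le hn 0] with z hz
    rw [weight, weight, Real.rpow_def_of_pos two_pos, ← Real.exp_add, ← hp]
    have := mul_le_mul_of_nonneg_left (h z hz.symm) hp0.le
    gcongr
    linarith
  have hint : Integrable fun z => weight n μ u ((2 : ℝ) ^ 2 • z) :=
    hW.comp_smul (by norm_num)
  have hle := integral_mono_ae hW (hint.const_mul _) hpt
  have hpos : 0 < ∫ z, weight n μ u z := integral_pos_of_ae_pos_on_ball hW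
    (fun z => (weight_pos z).le) (Eventually.of_forall fun z _ => weight_pos z)
  rw [integral_const_mul, Measure.integral_comp_smul, finrank_euclideanSpace_fin, smul_eq_mul,
    ← mul_assoc, abs_of_pos (by positivity), ← pow_mul, ← Real.rpow_natCast,
    ← Real.rpow_neg zero_le_two, ← Real.rpow_add two_pos] at hle
  have hlt : (2 : ℝ) ^ (2 * p + -((2 * n : ℕ) : ℝ)) < 1 :=
    Real.rpow_lt_one_of_one_lt_of_neg one_lt_two (by push_cast; linarith)
  nlinarith

theorem exists_positive_lambda (n : ℕ) (hn : 2 ≤ n) (μ : ℝ) (hμ0 : 0 < μ) (hμn : μ < n)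
    (u : EuclideanSpace ℝ (Fin n) → ℝ) (hu : ContDiff ℝ n u)
    (hB : CondB n μ u) (hIE : IE n μ u) :
    ∃ b : EuclideanSpace ℝ (Fin n), 0 < lambdaB n μ u b := by
  refine ⟨0, ?_⟩
  obtain ⟨l, hl⟩ := exists_start hn hμ0 hμn hu hB hIE
  obtain ⟨z, hz, hlt⟩ := exists_lt_of_integrable_weight hn hμ0 hμn hB.1
  have hz0 : 0 < ‖z‖ := norm_pos_iff.2 hz
  refine lt_of_lt_of_le (b := 1 / (2 * ‖z‖)) (by positivity) (le_csInf ⟨l, hl⟩ fun m hm => ?_)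
  by_contra! hlt'
  set ρ := 1 / (2 * ‖z‖) with hρ
  have hρ0 : 0 < ρ := by positivity
  have hx : ‖ρ ^ 2 • z‖ = ρ / 2 := by
    rw [norm_smul, Real.norm_of_nonneg (by positivity), hρ]
    field_simp
  have h := (hm.2 ρ hlt'.le (ρ ^ 2 • z) (by rw [hx]; positivity) (by rw [hx]; linarith)).1
  rw [wMS_zero_nonneg_iff hρ0 (by rw [hx]; positivity), hx,
    inv_smul_smul₀ (by positivity : ρ ^ 2 ≠ 0), show ρ / (ρ / 2) = 2 by field_simp] at h
  linarith
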